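/- arXiv:2311.04853 — 2 statements merged into one kernel-verified Lean document; each statement's English description precedes it below -/
import Mathlib

section
/- Let (a_n), (b_n) be N-periodically modulated Jacobi parameters such that tr 𝔛_N(0) ∈ (−2, 2), the sequences (a_{n−1}/a_n)_{n≥1}, (b_n/a_n)_{n≥0} and (1/a_n)_{n≥0} belong to D_1^N, and the Carleman condition Σ_{n≥0} 1/a_n = ∞ holds. Set ρ_n = Σ_{k=0}^{n} α_k/a_k. Then for every bounded continuous f : ℝ → ℝ with sup_{x∈ℝ} (1 + x²)·|f(x)| < ∞, one has (1/ρ_n) ∫ f dν_n → c·∫_ℝ f(x) dx as n → ∞, where c = |tr 𝔛_N'(0)| / (π·N·√(−discr 𝔛_N(0))). -/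
open Filter Topology

/-- The one–step matrix `𝔅_j(x)` associated with the `N`-periodic parameters `α, β`. -/
noncomputable def frakB (α β : ℤ → ℝ) (j : ℤ) (x : ℂ) : Matrix (Fin 2) (Fin 2) ℂ :=
  !![0, 1; -((α (j - 1) : ℂ) / (α j : ℂ)), (x - (β j : ℂ)) / (α j : ℂ)]

/-- The periodic `N`-step matrix `𝔛_n(x) = 𝔅_{n+N-1}(x) ⋯ 𝔅_n(x)`. -/
noncomputable def frakX (α β : ℤ → ℝ) (N : ℕ) (n : ℤ) (x : ℂ) : Matrix (Fin 2) (Fin 2) ℂ :=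
  (((List.range N).map (fun k => frakB α β (n + k) x)).reverse).prod

/-- The Stolz class `D₁ᴺ`: bounded sequences with `∑ |x_{n+N} - x_n| < ∞`. -/
def MemD1N (N : ℕ) (x : ℕ → ℝ) : Prop :=
  (∃ C : ℝ, ∀ n, |x n| ≤ C) ∧ Summable (fun n => |x (n + N) - x n|)


lemma aux_log_jensen (D t s : ℝ) (hD : 0 ≤ D) (ht : 0 < t) (hs : 0 < s) :
    t ^ 2 / (D + t ^ 2) * (2 * Real.log (s / t)) ≤ Real.log (D + s ^ 2) - Real.log (D + t ^ 2) := by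
  have hc := strictConcaveOn_log_Ioi.concaveOn.2
  have h := @hc 1 (by simp) ((s / t) ^ 2) (by simp; positivity) (D / (D + t ^ 2))
    (t ^ 2 / (D + t ^ 2)) (by positivity) (by positivity) (by field_simp)
  simp only [smul_eq_mul, Real.log_one, mul_zero, zero_add, mul_one] at h
  rw [Real.log_pow] at h
  rw [← Real.log_div (by positivity) (by positivity)]
  have e : D / (D + t ^ 2) + t ^ 2 / (D + t ^ 2) * (s / t) ^ 2 = (D + s ^ 2) / (D + t ^ 2) := by
    field_simp
  rw [e] at h
  exact_mod_cast h

lemma aux_poisson_of_log (Z : ℕ → Finset ℝ) (ρ : ℕ → ℝ) (hρ : ∀ n, 0 < ρ n) (κ : ℝ) (hκ : 0 ≤ κ)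
    (s : ℝ)
    (h : ∀ t t' : ℝ, 0 < t → t < t' → Tendsto (fun n => (ρ n)⁻¹ * ∑ y ∈ Z n,
      (Real.log ((s - y) ^ 2 + t' ^ 2) - Real.log ((s - y) ^ 2 + t ^ 2))) atTop
        (𝓝 (2 * κ * (t' - t)))) (t : ℝ) (ht : 0 < t) :
    Tendsto (fun n => (ρ n)⁻¹ * ∑ y ∈ Z n, t ^ 2 / ((s - y) ^ 2 + t ^ 2)) atTop (𝓝 (κ * t)) := by
  have up : ∀ t' : ℝ, t < t' → ∀ n, ((ρ n)⁻¹ * ∑ y ∈ Z n, t ^ 2 / ((s - y) ^ 2 + t ^ 2)) ≤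
      ((ρ n)⁻¹ * ∑ y ∈ Z n,
      (Real.log ((s - y) ^ 2 + t' ^ 2) - Real.log ((s - y) ^ 2 + t ^ 2))) / (2 * Real.log (t' / t)) := by
    intro t' ht' n
    have hl : 0 < Real.log (t' / t) := Real.log_pos (by rw [lt_div_iff₀ ht]; linarith)
    rw [le_div_iff₀ (by positivity), mul_assoc, Finset.sum_mul]
    refine mul_le_mul_of_nonneg_left (Finset.sum_le_sum fun y _ => ?_) (inv_nonneg.2 (hρ n).le)
    exact aux_log_jensen _ _ _ (sq_nonneg _) ht (ht.trans ht')
  have lo : ∀ t' : ℝ, 0 < t' → t' < t → ∀ n, 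
      ((ρ n)⁻¹ * ∑ y ∈ Z n,
      (Real.log ((s - y) ^ 2 + t ^ 2) - Real.log ((s - y) ^ 2 + t' ^ 2))) / (2 * Real.log (t / t')) 
      ≤ ((ρ n)⁻¹ * ∑ y ∈ Z n, t ^ 2 / ((s - y) ^ 2 + t ^ 2)) := by
    intro t' ht' htt n
    have hl : 0 < Real.log (t / t') := Real.log_pos (by rw [lt_div_iff₀ ht']; linarith)
    rw [div_le_iff₀ (by positivity), mul_assoc, Finset.sum_mul]
    refine mul_le_mul_of_nonneg_left (Finset.sum_le_sum fun y _ => ?_) (inv_nonneg.2 (hρ n).le)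
    have := aux_log_jensen _ _ _ (sq_nonneg (s - y)) ht ht'
    rw [← inv_div t t', Real.log_inv] at this
    linarith
  refine tendsto_order.2 ⟨fun c hc => ?_, fun c hc => ?_⟩
  · -- choose t' < t with c < κ t'
    obtain ⟨t', ht', htt, hct⟩ : ∃ t', 0 < t' ∧ t' < t ∧ c < κ * t' := by
      have h1 : ∀ᶠ x in 𝓝[<] t, c < κ * x :=
        ((continuous_const.mul continuous_id).tendsto t).mono_left nhdsWithin_le_nhds
          |>.eventually (lt_mem_nhds hc)
      have h2 : ∀ᶠ x in 𝓝[<] t, 0 < x :=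
        (tendsto_id.mono_left nhdsWithin_le_nhds).eventually (lt_mem_nhds ht)
      obtain ⟨x, hx1, hx2, hx3⟩ := (h1.and (h2.and self_mem_nhdsWithin)).exists
      exact ⟨x, hx2, hx3, hx1⟩
    have hl : 0 < Real.log (t / t') := Real.log_pos (by rw [lt_div_iff₀ ht']; linarith)
    have h3 := (h t' t ht' htt).div_const (2 * Real.log (t / t'))
    have h4 : κ * t' ≤ 2 * κ * (t - t') / (2 * Real.log (t / t')) := by
      rw [le_div_iff₀ (by positivity)]
      have := Real.log_le_sub_one_of_pos (x := t / t') (by positivity)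
      have : t' * Real.log (t / t') ≤ t - t' := by
        calc _ ≤ t' * (t / t' - 1) := by gcongr
          _ = _ := by field_simp
      nlinarith
    filter_upwards [h3.eventually (lt_mem_nhds (hct.trans_le h4))] with n hn
    exact hn.trans_le (lo t' ht' htt n)
  · obtain ⟨t', htt, hct⟩ : ∃ t', t < t' ∧ κ * t' < c := by
      have h1 : ∀ᶠ x in 𝓝[>] t, κ * x < c :=
        ((continuous_const.mul continuous_id).tendsto t).mono_left nhdsWithin_le_nhds
          |>.eventually (gt_mem_nhds hc)
      obtain ⟨x, hx1, hx3⟩ := (h1.and self_mem_nhdsWithin).exists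
      exact ⟨x, hx3, hx1⟩
    have ht' : 0 < t' := ht.trans htt
    have hl : 0 < Real.log (t' / t) := Real.log_pos (by rw [lt_div_iff₀ ht]; linarith)
    have h3 := (h t t' ht htt).div_const (2 * Real.log (t' / t))
    have h4 : 2 * κ * (t' - t) / (2 * Real.log (t' / t)) ≤ κ * t' := by
      rw [div_le_iff₀ (by positivity)]
      have := Real.one_sub_inv_le_log_of_pos (x := t' / t) (by positivity)
      have : t' - t ≤ t' * Real.log (t' / t) := by
        calc _ = t' * (1 - (t' / t)⁻¹) := by field_simp
          _ ≤ _ := by gcongr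
      nlinarith
    filter_upwards [h3.eventually (gt_mem_nhds (h4.trans_lt hct))] with n hn
    exact (up t' htt n).trans_lt hn

lemma aux_approx (x : ℕ → ℝ) (l : ℝ)
    (h : ∀ ε > 0, ∃ (x' : ℕ → ℝ) (l' : ℝ), Tendsto x' atTop (𝓝 l') ∧
      (∀ᶠ n in atTop, |x n - x' n| ≤ ε) ∧ |l - l'| ≤ ε) : Tendsto x atTop (𝓝 l) := by
  rw [Metric.tendsto_atTop']
  intro ε hε
  obtain ⟨x', l', h1, h2, h3⟩ := h (ε / 4) (by positivity)
  have h4 := (Metric.tendsto_nhds.1 h1) (ε / 4) (by positivity)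
  obtain ⟨N, hN⟩ := eventually_atTop.1 (h2.and h4)
  refine ⟨N, fun n hn => ?_⟩
  obtain ⟨h5, h6⟩ := hN n hn.le
  rw [Real.dist_eq] at h6 ⊢
  rw [abs_lt] at *
  rw [abs_le] at *
  constructor <;> linarith [h5.1, h5.2, h6.1, h6.2, h3.1, h3.2]

lemma aux_approx_id (δ : ℝ) (hδ : 0 < δ) :
    Tendsto (fun t : ℝ => ∫ v : ℝ, min 1 (t * |v| / δ) * (1 + v ^ 2)⁻¹) (𝓝[>] 0) (𝓝 0) := by
  have := MeasureTheory.tendsto_integral_filter_of_dominated_convergence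
    (μ := MeasureTheory.volume) (l := 𝓝[>] (0:ℝ)) (f := fun _ : ℝ => (0:ℝ))
    (F := fun t v : ℝ => min 1 (t * |v| / δ) * (1 + v ^ 2)⁻¹) (fun v => (1 + v ^ 2)⁻¹)
    (by
      refine Eventually.of_forall fun t => Continuous.aestronglyMeasurable ?_
      have : ∀ v : ℝ, 1 + v ^ 2 ≠ 0 := fun v => by positivity
      fun_prop (disch := assumption))
    (by
      filter_upwards [self_mem_nhdsWithin] with t ht
      refine Eventually.of_forall fun v => ?_
      have ht : 0 < t := ht
      have h0 : 0 ≤ min 1 (t * |v| / δ) := le_min zero_le_one (by positivity)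
      rw [Real.norm_of_nonneg (mul_nonneg h0 (by positivity))]
      exact mul_le_of_le_one_left (by positivity) (min_le_left _ _))
    integrable_inv_one_add_sq
    (by
      refine Eventually.of_forall fun v => ?_
      have : Tendsto (fun t : ℝ => min 1 (t * |v| / δ) * (1 + v ^ 2)⁻¹) (𝓝 0)
          (𝓝 (min 1 (0 * |v| / δ) * (1 + v ^ 2)⁻¹)) := by
        apply Continuous.tendsto
        fun_prop
      simp only [zero_mul, zero_div, min_eq_right zero_le_one] at this
      exact this.mono_left nhdsWithin_le_nhds)
  simpa using this


lemma aux_change (f : ℝ → ℝ) (y t : ℝ) (ht : 0 < t) :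
    ∫ v : ℝ, f (y + t * v) * (1 + v ^ 2)⁻¹ =
      t⁻¹ * ∫ s : ℝ, f s * (t ^ 2 / ((s - y) ^ 2 + t ^ 2)) := by
  have h1 := MeasureTheory.Measure.integral_comp_mul_left
    (fun u => f (y + u) * (t ^ 2 / ((y + u - y) ^ 2 + t ^ 2))) t
  have h2 := MeasureTheory.integral_add_left_eq_self (μ := MeasureTheory.volume)
    (fun s => f s * (t ^ 2 / ((s - y) ^ 2 + t ^ 2))) y
  rw [h2, abs_of_pos (inv_pos.2 ht), smul_eq_mul] at h1
  rw [← h1]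
  congr 1
  ext v
  congr 1
  rw [add_sub_cancel_left]
  field_simp
  ring

lemma aux_unif (f : ℝ → ℝ) (hf : Continuous f) (hs : HasCompactSupport f) (ε : ℝ) (hε : 0 < ε) :
    ∃ t₀ > 0, ∀ t, 0 < t → t < t₀ → ∀ y,
      |Real.pi⁻¹ * (t⁻¹ * ∫ s : ℝ, f s * (t ^ 2 / ((s - y) ^ 2 + t ^ 2))) - f y|
        ≤ ε * (1 + y ^ 2)⁻¹ := by
  obtain ⟨M, hM⟩ := hs.exists_bound_of_continuous hf
  have hM0 : 0 ≤ M := (norm_nonneg _).trans (hM 0)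
  obtain ⟨R₀, hR₀⟩ := hs.isCompact.isBounded.exists_norm_le
  set R := max R₀ 1 with hRdef
  have hR1 : 1 ≤ R := le_max_right _ _
  have hsupp : ∀ s, R < |s| → f s = 0 := by
    intro s hs'
    by_contra h
    have := hR₀ s (subset_tsupport f h)
    exact absurd (this.trans (le_max_left R₀ 1)) (not_le.2 hs')
  have huc := hs.uniformContinuous_of_continuous hf
  set η := ε / (2 * (1 + 4 * R ^ 2)) with hη
  have hη0 : 0 < η := by positivity
  obtain ⟨δ, hδ, hδ'⟩ := Metric.uniformContinuous_iff.1 huc η hη0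
  have hpi := Real.pi_pos
  set I := ∫ s, |f s| with hI
  have hI0 : 0 ≤ I := MeasureTheory.integral_nonneg fun _ => abs_nonneg _
  have hfi : MeasureTheory.Integrable f := hf.integrable_of_hasCompactSupport hs
  have ev1 : ∀ᶠ t in 𝓝[>] (0:ℝ), (2 * M / Real.pi) *
      (∫ v : ℝ, min 1 (t * |v| / δ) * (1 + v ^ 2)⁻¹) < η := by
    have := (aux_approx_id δ hδ).const_mul (2 * M / Real.pi)
    rw [mul_zero] at this
    exact this.eventually (gt_mem_nhds hη0)
  have ev2 : ∀ᶠ t in 𝓝[>] (0:ℝ), 8 * t * I / Real.pi < ε := by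
    have : Tendsto (fun t : ℝ => 8 * t * I / Real.pi) (𝓝 0) (𝓝 (8 * 0 * I / Real.pi)) :=
      Continuous.tendsto (by fun_prop) _
    simp only [mul_zero, zero_mul, zero_div] at this
    exact (this.mono_left nhdsWithin_le_nhds).eventually (gt_mem_nhds hε)
  obtain ⟨t₀, ht₀, H⟩ := mem_nhdsGT_iff_exists_Ioo_subset.1 (ev1.and ev2)
  refine ⟨t₀, ht₀, fun t ht htt y => ?_⟩
  obtain ⟨h1, h2⟩ := H ⟨ht, htt⟩
  rcases le_or_gt |y| (2 * R) with hy | hy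
  · rw [← aux_change f y t ht]
    have hne : ∀ v : ℝ, 1 + v ^ 2 ≠ 0 := fun v => by positivity
    have i1 : MeasureTheory.Integrable fun v : ℝ => f (y + t * v) * (1 + v ^ 2)⁻¹ := by
      refine (integrable_inv_one_add_sq.const_mul M).mono' (Continuous.aestronglyMeasurable
        (by fun_prop (disch := assumption))) (Eventually.of_forall fun v => ?_)
      rw [norm_mul, Real.norm_of_nonneg (by positivity : 0 ≤ (1 + v ^ 2)⁻¹)]
      exact mul_le_mul_of_nonneg_right (hM _) (by positivity)
    have i2 : MeasureTheory.Integrable fun v : ℝ => min 1 (t * |v| / δ) * (1 + v ^ 2)⁻¹ := by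
      refine (integrable_inv_one_add_sq).mono' (Continuous.aestronglyMeasurable
        (by fun_prop (disch := assumption))) (Eventually.of_forall fun v => ?_)
      have h0 : 0 ≤ min 1 (t * |v| / δ) := le_min zero_le_one (by positivity)
      rw [Real.norm_of_nonneg (mul_nonneg h0 (by positivity))]
      exact mul_le_of_le_one_left (by positivity) (min_le_left _ _)
    have e1 : f y = Real.pi⁻¹ * ∫ v : ℝ, f y * (1 + v ^ 2)⁻¹ := by
      rw [MeasureTheory.integral_const_mul, integral_univ_inv_one_add_sq]
      field_simp
    have e2 : |Real.pi⁻¹ * (∫ v : ℝ, f (y + t * v) * (1 + v ^ 2)⁻¹) - f y| ≤ 2 * η := by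
      rw [e1, ← mul_sub, ← MeasureTheory.integral_sub i1 (integrable_inv_one_add_sq.const_mul _),
        abs_mul, abs_of_pos (inv_pos.2 hpi)]
      have : ‖∫ v : ℝ, (f (y + t * v) * (1 + v ^ 2)⁻¹ - f y * (1 + v ^ 2)⁻¹)‖ ≤
          ∫ v : ℝ, (η * (1 + v ^ 2)⁻¹ + 2 * M * (min 1 (t * |v| / δ) * (1 + v ^ 2)⁻¹)) := by
        refine MeasureTheory.norm_integral_le_of_norm_le
          ((integrable_inv_one_add_sq.const_mul _).add (i2.const_mul _))
          (Eventually.of_forall fun v => ?_)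
        rw [← sub_mul, norm_mul, Real.norm_of_nonneg (by positivity : 0 ≤ (1 + v ^ 2)⁻¹),
          ← mul_assoc, ← add_mul]
        refine mul_le_mul_of_nonneg_right ?_ (by positivity)
        rcases lt_or_ge (t * |v|) δ with hv | hv
        · have := hδ' (a := y + t * v) (b := y) (by
            rw [Real.dist_eq, add_sub_cancel_left, abs_mul, abs_of_pos ht]; exact hv)
          rw [Real.dist_eq] at this
          rw [Real.norm_eq_abs]
          have h0 : 0 ≤ min 1 (t * |v| / δ) := le_min zero_le_one (by positivity)
          have := mul_nonneg (mul_nonneg zero_le_two hM0) h0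
          linarith
        · rw [min_eq_left (by rw [le_div_iff₀ hδ]; linarith)]
          have := norm_sub_le (f (y + t * v)) (f y)
          linarith [hM (y + t * v), hM y]
      rw [MeasureTheory.integral_add (integrable_inv_one_add_sq.const_mul _) (i2.const_mul _),
        MeasureTheory.integral_const_mul, MeasureTheory.integral_const_mul,
        integral_univ_inv_one_add_sq, Real.norm_eq_abs] at this
      calc _ ≤ Real.pi⁻¹ * _ := mul_le_mul_of_nonneg_left this (by positivity)
        _ = η + (2 * M / Real.pi) *
              (∫ v : ℝ, min 1 (t * |v| / δ) * (1 + v ^ 2)⁻¹) := by field_simp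
        _ ≤ 2 * η := by linarith
    refine e2.trans ?_
    rw [hη, ← div_eq_mul_inv]
    have hy2 : y ^ 2 ≤ 4 * R ^ 2 := by
      have := sq_le_sq' (by linarith [abs_nonneg y]) hy
      rw [sq_abs] at this; nlinarith
    calc 2 * (ε / (2 * (1 + 4 * R ^ 2))) = ε / (1 + 4 * R ^ 2) := by field_simp
      _ ≤ _ := by gcongr
  · rw [hsupp y (by linarith), sub_zero, abs_mul, abs_mul, abs_of_pos (inv_pos.2 hpi),
      abs_of_pos (inv_pos.2 ht)]
    have hy0 : 0 < y ^ 2 := by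
      have : 0 < |y| := by linarith
      have : y ≠ 0 := abs_pos.1 this
      positivity
    have hy2 : 1 ≤ y ^ 2 := by
      rw [← sq_abs]; nlinarith
    have : ‖∫ s : ℝ, f s * (t ^ 2 / ((s - y) ^ 2 + t ^ 2))‖ ≤ ∫ s : ℝ, |f s| * (t ^ 2 * 4 / y ^ 2) := by
      refine MeasureTheory.norm_integral_le_of_norm_le (hfi.abs.mul_const _)
        (Eventually.of_forall fun s => ?_)
      rw [norm_mul, Real.norm_of_nonneg (by positivity : 0 ≤ t ^ 2 / ((s - y) ^ 2 + t ^ 2)),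
        Real.norm_eq_abs]
      rcases le_or_gt |s| R with hsR | hsR
      · refine mul_le_mul_of_nonneg_left ?_ (abs_nonneg _)
        rw [div_le_div_iff₀ (by positivity) hy0]
        have h3 : |y| / 2 ≤ |s - y| := by
          have := abs_sub_abs_le_abs_sub y s
          rw [abs_sub_comm] at this
          linarith
        have h4 : y ^ 2 ≤ 4 * (s - y) ^ 2 := by
          rw [← sq_abs y, ← sq_abs (s - y)]
          nlinarith [abs_nonneg y]
        nlinarith [sq_nonneg t, mul_nonneg (sq_nonneg t) (sub_nonneg.2 h4)]
      · rw [hsupp s hsR]; simp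
    rw [MeasureTheory.integral_mul_const, Real.norm_eq_abs] at this
    calc _ ≤ Real.pi⁻¹ * (t⁻¹ * ((∫ s, |f s|) * (t ^ 2 * 4 / y ^ 2))) := by gcongr
      _ = (8 * t * I / Real.pi) * (2 * y ^ 2)⁻¹ := by
        rw [← hI]; field_simp; ring
      _ ≤ ε * (1 + y ^ 2)⁻¹ := by
        gcongr
        linarith

lemma aux_cc (Z : ℕ → Finset ℝ) (ρ : ℕ → ℝ) (hρ : ∀ n, 0 < ρ n) (κ : ℝ) (hκ : 0 ≤ κ)
    (hP : ∀ s t : ℝ, 0 < t → Tendsto (fun n => (ρ n)⁻¹ * ∑ y ∈ Z n, t ^ 2 / ((s - y) ^ 2 + t ^ 2))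
      atTop (𝓝 (κ * t)))
    (f : ℝ → ℝ) (hf : Continuous f) (hs : HasCompactSupport f) :
    Tendsto (fun n => (ρ n)⁻¹ * ∑ y ∈ Z n, f y) atTop (𝓝 (κ / Real.pi * ∫ x, f x)) := by
  have hpi := Real.pi_pos
  have hq : ∀ᶠ n in atTop, (ρ n)⁻¹ * ∑ y ∈ Z n, (1 + y ^ 2)⁻¹ ≤ κ + 1 := by
    have h := hP 0 1 one_pos
    rw [mul_one] at h
    filter_upwards [h.eventually (gt_mem_nhds (lt_add_one κ))] with n hn
    refine le_trans (le_of_eq ?_) hn.le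
    congr 1
    refine Finset.sum_congr rfl fun y _ => ?_
    rw [inv_eq_one_div]; congr 1 <;> ring
  refine aux_approx _ _ fun ε hε => ?_
  obtain ⟨t₀, ht₀, H⟩ := aux_unif f hf hs (ε / (κ + 1)) (by positivity)
  set t := t₀ / 2 with htdef
  have ht : 0 < t := by positivity
  have Ht := H t ht (by linarith)
  have hden : ∀ y s : ℝ, (s - y) ^ 2 + t ^ 2 ≠ 0 := fun y s => by positivity
  refine ⟨fun n => (ρ n)⁻¹ * ∑ y ∈ Z n,
    Real.pi⁻¹ * (t⁻¹ * ∫ s : ℝ, f s * (t ^ 2 / ((s - y) ^ 2 + t ^ 2))), κ / Real.pi * ∫ x, f x,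
    ?_, ?_, by simpa using hε.le⟩
  · have e : ∀ n, (ρ n)⁻¹ * ∑ y ∈ Z n,
        Real.pi⁻¹ * (t⁻¹ * ∫ s : ℝ, f s * (t ^ 2 / ((s - y) ^ 2 + t ^ 2))) =
        Real.pi⁻¹ * t⁻¹ * ∫ s : ℝ, f s * ((ρ n)⁻¹ * ∑ y ∈ Z n, t ^ 2 / ((s - y) ^ 2 + t ^ 2)) := by
      intro n
      have : ∀ s : ℝ, f s * ((ρ n)⁻¹ * ∑ y ∈ Z n, t ^ 2 / ((s - y) ^ 2 + t ^ 2)) =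
          (ρ n)⁻¹ * ∑ y ∈ Z n, f s * (t ^ 2 / ((s - y) ^ 2 + t ^ 2)) := by
        intro s; rw [mul_left_comm, Finset.mul_sum]
      simp_rw [this]
      rw [MeasureTheory.integral_const_mul, MeasureTheory.integral_finsetSum]
      · rw [← Finset.mul_sum, ← Finset.mul_sum]; ring
      · intro y _
        refine Continuous.integrable_of_hasCompactSupport ?_ hs.mul_right
        have := hden y
        fun_prop (disch := assumption)
    simp_rw [e]
    obtain ⟨R, hR⟩ := hs.isCompact.isBounded.exists_norm_le
    have hfi : MeasureTheory.Integrable f := hf.integrable_of_hasCompactSupport hs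
    have key : Tendsto (fun n => ∫ s : ℝ, f s * ((ρ n)⁻¹ * ∑ y ∈ Z n, t ^ 2 / ((s - y) ^ 2 + t ^ 2)))
        atTop (𝓝 (∫ s : ℝ, f s * (κ * t))) := by
      refine MeasureTheory.tendsto_integral_filter_of_dominated_convergence
        (fun s => |f s| * ((1 + 2 * R ^ 2 + 2 * t ^ 2) * (κ + 1))) ?_ ?_ (hfi.abs.mul_const _) ?_
      · refine Eventually.of_forall fun n => Continuous.aestronglyMeasurable ?_
        refine hf.mul (continuous_const.mul (continuous_finsetSum _ fun y _ => ?_))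
        have := hden y
        fun_prop (disch := assumption)
      · filter_upwards [hq] with n hn
        refine Eventually.of_forall fun s => ?_
        have h0 : 0 ≤ (ρ n)⁻¹ * ∑ y ∈ Z n, t ^ 2 / ((s - y) ^ 2 + t ^ 2) :=
          mul_nonneg (inv_nonneg.2 (hρ n).le) (Finset.sum_nonneg fun y _ => by positivity)
        rw [norm_mul, Real.norm_of_nonneg h0, Real.norm_eq_abs]
        by_cases hfs : f s = 0
        · simp [hfs]
        have hsR : s ^ 2 ≤ R ^ 2 := by
          have := hR s (subset_tsupport f hfs)
          rw [← sq_abs s]; exact pow_le_pow_left₀ (abs_nonneg _) this 2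
        refine mul_le_mul_of_nonneg_left ?_ (abs_nonneg _)
        refine le_trans ?_ (mul_le_mul_of_nonneg_left hn (by positivity))
        rw [mul_left_comm (1 + 2 * R ^ 2 + 2 * t ^ 2),
          Finset.mul_sum _ _ (1 + 2 * R ^ 2 + 2 * t ^ 2)]
        refine mul_le_mul_of_nonneg_left (Finset.sum_le_sum fun y _ => ?_) (inv_nonneg.2 (hρ n).le)
        rw [← div_eq_mul_inv, div_le_div_iff₀ (by positivity) (by positivity)]
        nlinarith [sq_nonneg (2 * s - y), sq_nonneg t, sq_nonneg (s - y), mul_nonneg (sq_nonneg t) (sq_nonneg (2 * s - y)),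
          mul_nonneg (sq_nonneg t) (sub_nonneg.2 hsR), mul_nonneg (sq_nonneg t) (sq_nonneg t),
          mul_nonneg (sq_nonneg (s - y)) (sq_nonneg R), sq_nonneg (t ^ 2)]
      · exact Eventually.of_forall fun s => (hP s t ht).const_mul _
    have := key.const_mul (Real.pi⁻¹ * t⁻¹)
    rw [MeasureTheory.integral_mul_const] at this
    convert this using 2
    field_simp
  · filter_upwards [hq] with n hn
    rw [← mul_sub, ← Finset.sum_sub_distrib, abs_mul, abs_of_pos (inv_pos.2 (hρ n))]
    calc _ ≤ (ρ n)⁻¹ * ∑ y ∈ Z n, ε / (κ + 1) * (1 + y ^ 2)⁻¹ := by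
          refine mul_le_mul_of_nonneg_left ?_ (inv_nonneg.2 (hρ n).le)
          refine (Finset.abs_sum_le_sum_abs _ _).trans (Finset.sum_le_sum fun y _ => ?_)
          rw [abs_sub_comm]; exact Ht y
      _ = ε / (κ + 1) * ((ρ n)⁻¹ * ∑ y ∈ Z n, (1 + y ^ 2)⁻¹) := by
          rw [← Finset.mul_sum]; ring
      _ ≤ ε / (κ + 1) * (κ + 1) := by gcongr
      _ = ε := by field_simp

lemma aux_full (Z : ℕ → Finset ℝ) (ρ : ℕ → ℝ) (hρ : ∀ n, 0 < ρ n) (κ : ℝ) (hκ : 0 ≤ κ)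
    (hP : ∀ s t : ℝ, 0 < t → Tendsto (fun n => (ρ n)⁻¹ * ∑ y ∈ Z n, t ^ 2 / ((s - y) ^ 2 + t ^ 2))
      atTop (𝓝 (κ * t)))
    (f : ℝ → ℝ) (hf : Continuous f) (C : ℝ) (hC : ∀ x, (1 + x ^ 2) * |f x| ≤ C) :
    Tendsto (fun n => (ρ n)⁻¹ * ∑ y ∈ Z n, f y) atTop (𝓝 (κ / Real.pi * ∫ x, f x)) := by
  have hpi := Real.pi_pos
  have hC0 : 0 ≤ C := le_trans (by positivity) (hC 0)
  have hfq : ∀ x, |f x| ≤ C * (1 + x ^ 2)⁻¹ := fun x => by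
    rw [← div_eq_mul_inv, le_div_iff₀ (by positivity), mul_comm]; exact hC x
  have hfi : MeasureTheory.Integrable f :=
    (integrable_inv_one_add_sq.const_mul C).mono' hf.aestronglyMeasurable
      (Eventually.of_forall hfq)
  let χ : ℝ → ℝ → ℝ := fun R x => max 0 (min 1 (R + 1 - |x|))
  have hχc : ∀ R, Continuous (χ R) := fun R => by fun_prop
  have hχ0 : ∀ R x, 0 ≤ χ R x := fun R x => le_max_left _ _
  have hχ1 : ∀ R x, χ R x ≤ 1 := fun R x => max_le zero_le_one (min_le_left _ _)
  have hχs : ∀ R, HasCompactSupport (χ R) := fun R => by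
    refine HasCompactSupport.intro (isCompact_Icc (a := -(R + 1)) (b := R + 1)) fun x hx => ?_
    have : R + 1 < |x| := by
      by_contra h
      exact hx (abs_le.1 (not_lt.1 h))
    exact max_eq_left ((min_le_right _ _).trans (by linarith))
  have hχl : ∀ x, Tendsto (fun R => χ R x) atTop (𝓝 1) := fun x => by
    refine tendsto_const_nhds.congr' ?_
    filter_upwards [eventually_ge_atTop |x|] with R hR
    simp only [χ]
    rw [min_eq_left (by linarith), max_eq_right zero_le_one]
  have hqc : Continuous fun x : ℝ => (1 + x ^ 2)⁻¹ := by
    have hne : ∀ v : ℝ, 1 + v ^ 2 ≠ 0 := fun v => by positivity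
    fun_prop (disch := assumption)
  have lim : ∀ g : ℝ → ℝ, Continuous g → MeasureTheory.Integrable g →
      Tendsto (fun R => ∫ x, g x * χ R x) atTop (𝓝 (∫ x, g x)) := by
    intro g hg hgi
    refine MeasureTheory.tendsto_integral_filter_of_dominated_convergence
        (fun s => |g s|) (Eventually.of_forall fun R => (hg.mul (hχc R)).aestronglyMeasurable)
        (Eventually.of_forall fun R => Eventually.of_forall fun x => ?_) hgi.abs
        (Eventually.of_forall fun x => ?_)
    · rw [norm_mul, Real.norm_of_nonneg (hχ0 R x), Real.norm_eq_abs]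
      exact mul_le_of_le_one_right (abs_nonneg _) (hχ1 R x)
    · simpa using (hχl x).const_mul (g x)
  have hQ : Tendsto (fun n => (ρ n)⁻¹ * ∑ y ∈ Z n, (1 + y ^ 2)⁻¹) atTop (𝓝 κ) := by
    have h := hP 0 1 one_pos
    rw [mul_one] at h
    refine h.congr fun n => ?_
    congr 1
    refine Finset.sum_congr rfl fun y _ => ?_
    rw [inv_eq_one_div]; congr 1 <;> ring
  refine aux_approx _ _ fun ε hε => ?_
  have l1 := (lim f hf hfi).const_mul (κ / Real.pi)
  have l2 := ((lim _ hqc integrable_inv_one_add_sq).const_mul (κ / Real.pi)).const_sub κ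
  have l2 := l2.const_mul C
  rw [integral_univ_inv_one_add_sq, div_mul_cancel₀ _ hpi.ne', sub_self, mul_zero] at l2
  obtain ⟨R, hR1, hR2⟩ := ((l1.eventually (Metric.ball_mem_nhds _ hε)).and
    (l2.eventually (gt_mem_nhds hε))).exists
  refine ⟨fun n => (ρ n)⁻¹ * ∑ y ∈ Z n, f y * χ R y, κ / Real.pi * ∫ x, f x * χ R x,
    aux_cc Z ρ hρ κ hκ hP _ (hf.mul (hχc R)) (hχs R).mul_left, ?_, ?_⟩
  · have l3 := aux_cc Z ρ hρ κ hκ hP (fun x => (1 + x ^ 2)⁻¹ * χ R x) (hqc.mul (hχc R))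
      (hχs R).mul_left
    have l4 := (hQ.sub l3).const_mul C
    filter_upwards [l4.eventually (gt_mem_nhds hR2)] with n hn
    refine le_trans ?_ hn.le
    rw [← mul_sub, ← mul_sub, ← Finset.sum_sub_distrib, ← Finset.sum_sub_distrib, abs_mul,
      abs_of_pos (inv_pos.2 (hρ n)), mul_left_comm, Finset.mul_sum]
    refine mul_le_mul_of_nonneg_left ?_ (inv_nonneg.2 (hρ n).le)
    refine (Finset.abs_sum_le_sum_abs _ _).trans (Finset.sum_le_sum fun y _ => ?_)
    have h5 : 0 ≤ 1 - χ R y := sub_nonneg.2 (hχ1 R y)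
    calc |f y - f y * χ R y| = |f y| * (1 - χ R y) := by
          rw [← mul_one_sub, abs_mul, abs_of_nonneg h5]
      _ ≤ C * (1 + y ^ 2)⁻¹ * (1 - χ R y) := mul_le_mul_of_nonneg_right (hfq y) h5
      _ = _ := by ring
  · rw [abs_sub_comm]
    exact (Metric.mem_ball.1 hR1).le


lemma aux_scalar (u x e : ℕ → ℝ) (hu : ∀ k, 0 ≤ u k) (hx0 : ∀ k, 0 ≤ x k)
    (he0 : ∀ k, 0 ≤ e k) (he : Summable e)
    (hx : Tendsto (fun n => ∑ k ∈ Finset.range n, x k) atTop atTop)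
    (h : ∀ k, u (k + 1) ≤ (1 + e k) * ((1 - x k) * u k) + e k) :
    Tendsto u atTop (𝓝 0) := by
  -- boundedness
  obtain ⟨D, hD0, hD⟩ : ∃ D, 0 ≤ D ∧ ∀ k, u k ≤ D := by
    have hb : ∀ k, u k + 1 ≤ (u 0 + 1) * Real.exp (∑ i ∈ Finset.range k, e i) := by
      intro k
      induction k with
      | zero => simp
      | succ k ih =>
        rw [Finset.sum_range_succ, Real.exp_add]
        have h1 : u (k + 1) + 1 ≤ (1 + e k) * (u k + 1) := by
          have h2 : (1 - x k) * u k ≤ u k := by nlinarith [hx0 k, hu k]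
          have := mul_le_mul_of_nonneg_left h2 (by linarith [he0 k] : 0 ≤ 1 + e k)
          nlinarith [h k]
        have h3 : 1 + e k ≤ Real.exp (e k) := by linarith [Real.add_one_le_exp (e k)]
        calc u (k + 1) + 1 ≤ (1 + e k) * (u k + 1) := h1
          _ ≤ Real.exp (e k) * ((u 0 + 1) * Real.exp (∑ i ∈ Finset.range k, e i)) :=
            mul_le_mul h3 ih (by linarith [hu k]) (Real.exp_pos _).le
          _ = _ := by ring
    refine ⟨(u 0 + 1) * Real.exp (∑' i, e i), mul_nonneg (by linarith [hu 0]) (Real.exp_pos _).le,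
      fun k => ?_⟩
    have h4 : ∑ i ∈ Finset.range k, e i ≤ ∑' i, e i := he.sum_le_tsum _ (fun i _ => he0 i)
    have := mul_le_mul_of_nonneg_left (Real.exp_le_exp.2 h4) (by linarith [hu 0] : 0 ≤ u 0 + 1)
    linarith [hb k]
  have h2 : ∀ k, u (k + 1) ≤ (1 - x k) * u k + (D + 1) * e k := by
    intro k
    have : (1 - x k) * u k ≤ D := by nlinarith [hx0 k, hu k, hD k]
    nlinarith [h k, he0 k]
  -- telescoped
  let s : ℕ → ℝ := fun n => u n - ∑ k ∈ Finset.range n, (D + 1) * e k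
  have hs : Antitone s := by
    refine antitone_nat_of_succ_le fun n => ?_
    simp only [s]
    rw [Finset.sum_range_succ]
    nlinarith [h2 n, hx0 n, hu n, mul_nonneg (hx0 n) (hu n)]
  have hEs : Summable fun k => (D + 1) * e k := he.mul_left _
  have hE := hEs.hasSum.tendsto_sum_nat
  have hE' : ∀ n, ∑ k ∈ Finset.range n, (D + 1) * e k ≤ ∑' k, (D + 1) * e k := fun n =>
    hEs.sum_le_tsum _ (fun i _ => mul_nonneg (by linarith) (he0 i))
  have hsb : BddBelow (Set.range s) := by
    refine ⟨- ∑' k, (D + 1) * e k, ?_⟩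
    rintro _ ⟨n, rfl⟩
    simp only [s]
    linarith [hu n, hE' n]
  have hsl := tendsto_atTop_ciInf hs hsb
  have hul : Tendsto u atTop (𝓝 ((⨅ i, s i) + ∑' k, (D + 1) * e k)) := by
    refine (hsl.add hE).congr fun n => ?_
    simp [s]
  set l := (⨅ i, s i) + ∑' k, (D + 1) * e k with hl
  have hl0 : 0 ≤ l := ge_of_tendsto' hul hu
  rcases hl0.eq_or_lt with h0 | h0
  · rw [h0]; exact hul
  exfalso
  obtain ⟨K, hK⟩ := eventually_atTop.1 (hul.eventually (lt_mem_nhds (half_lt_self h0)))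
  have hsum : ∀ n, K ≤ n → l / 2 * (∑ k ∈ Finset.range n, x k) ≤
      l / 2 * (∑ k ∈ Finset.range K, x k) + s K - s n := by
    intro n hn
    induction n, hn using Nat.le_induction with
    | base => linarith
    | succ n hn ih =>
      rw [Finset.sum_range_succ, mul_add]
      have h5 : s (n + 1) ≤ s n - x n * u n := by
        simp only [s]
        rw [Finset.sum_range_succ]
        nlinarith [h2 n]
      nlinarith [hK n hn, hx0 n]
  obtain ⟨m, hm⟩ := hsb
  have hb : ∀ n, K ≤ n → l / 2 * (∑ k ∈ Finset.range n, x k) ≤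
      l / 2 * (∑ k ∈ Finset.range K, x k) + s K - m := fun n hn => by
    linarith [hsum n hn, hm ⟨n, rfl⟩]
  have ht := (hx.const_mul_atTop (half_pos h0)).eventually_gt_atTop
    (l / 2 * (∑ k ∈ Finset.range K, x k) + s K - m)
  obtain ⟨n, hn1, hn2⟩ := (ht.and (eventually_ge_atTop K)).exists
  linarith [hb n hn2]

lemma aux_classes {E : Type*} [TopologicalSpace E] (N : ℕ) (hN : 1 ≤ N) (x : ℕ → E) (l : Filter E)
    (h : ∀ j, Tendsto (fun k => x (k * N + j)) atTop l) : Tendsto x atTop l := by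
  intro s hs
  have : ∀ᶠ k in atTop, ∀ j ∈ Finset.range N, x (k * N + j) ∈ s := by
    rw [Filter.eventually_all_finset]
    exact fun j _ => h j hs
  obtain ⟨K, hK⟩ := eventually_atTop.1 this
  refine mem_map.2 (mem_atTop_sets.2 ⟨K * N, fun n hn => ?_⟩)
  have := hK (n / N) ((Nat.le_div_iff_mul_le (by omega)).2 hn) (n % N)
    (Finset.mem_range.2 (Nat.mod_lt _ (by omega)))
  rwa [Nat.div_add_mod' n N] at this

lemma aux_periodic_bdd (N : ℕ) (hN : 1 ≤ N) (D : ℕ → ℝ) (h : ∀ k, D (k + N) = D k) :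
    ∃ C, 0 ≤ C ∧ ∀ k, |D k| ≤ C := by
  refine ⟨∑ j ∈ Finset.range N, |D j|, Finset.sum_nonneg fun _ _ => abs_nonneg _, fun k => ?_⟩
  have hp : Function.Periodic D N := h
  rw [← hp.map_mod_nat k]
  exact Finset.single_le_sum (f := fun j => |D j|) (fun _ _ => abs_nonneg _)
    (Finset.mem_range.2 (Nat.mod_lt _ (by omega)))

/-- weighted averages of periodic sequences -/
lemma aux_cesaro (N : ℕ) (hN : 1 ≤ N) (ω e π : ℕ → ℝ) (t : ℝ) (hω : ∀ k, 0 < ω k)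
    (hsum : Tendsto (fun n => ∑ k ∈ Finset.range n, ω k) atTop atTop)
    (hωb : ∃ C, ∀ k, ω k ≤ C)
    (hr : Tendsto (fun k => ω (k + 1) / ω k) atTop (𝓝 1))
    (hπ : ∀ k, π (k + N) = π k)
    (he : Tendsto (fun k => e k / ω k - t * π k) atTop (𝓝 0)) :
    Tendsto (fun n => (∑ k ∈ Finset.range n, e k) / ∑ k ∈ Finset.range n, ω k) atTop
      (𝓝 (t * ((∑ j ∈ Finset.range N, π j) / N))) := by
  have hN0 : (N : ℝ) ≠ 0 := by positivity
  set m := (∑ j ∈ Finset.range N, π j) / N with hm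
  let D : ℕ → ℝ := fun n => ∑ k ∈ Finset.range n, (π k - m)
  have hD : ∀ k, D (k + N) = D k := by
    intro k
    have h0 : D N = 0 := by
      simp only [D]
      rw [Finset.sum_sub_distrib, Finset.sum_const, Finset.card_range, hm]
      rw [nsmul_eq_mul, mul_div_cancel₀ _ hN0, sub_self]
    induction k with
    | zero => simp only [zero_add, h0]; simp [D]
    | succ k ih =>
      have : D (k + N + 1) = D (k + N) + (π (k + N) - m) := Finset.sum_range_succ _ _
      rw [show k + 1 + N = k + N + 1 by ring, this, ih, hπ]
      exact (Finset.sum_range_succ _ _).symm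
  obtain ⟨C, hC0, hC⟩ := aux_periodic_bdd N hN D hD
  obtain ⟨C', hC'⟩ := hωb
  -- e k = t m ω k + (e k - t π k ω k) + t ω k (π k - m)
  have o1 : (fun n => ∑ k ∈ Finset.range n, (e k - t * π k * ω k)) =o[atTop]
      (fun n => ∑ k ∈ Finset.range n, ω k) := by
    refine Asymptotics.IsLittleO.sum_range ?_ (fun k => (hω k).le) hsum
    rw [Asymptotics.isLittleO_iff_tendsto (fun k hk => absurd hk (hω k).ne')]
    refine he.congr fun k => ?_
    have := (hω k).ne'
    field_simp
  have o2 : (fun n => ∑ k ∈ Finset.range n, (ω k - ω (k + 1)) * D (k + 1)) =o[atTop]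
      (fun n => ∑ k ∈ Finset.range n, ω k) := by
    refine Asymptotics.IsLittleO.sum_range ?_ (fun k => (hω k).le) hsum
    rw [Asymptotics.isLittleO_iff_tendsto (fun k hk => absurd hk (hω k).ne')]
    have : Tendsto (fun k => (1 - ω (k + 1) / ω k) * C) atTop (𝓝 0) := by
      simpa using (hr.const_sub 1).mul_const C
    refine squeeze_zero_norm (fun k => ?_) (by simpa using this.abs)
    rw [Real.norm_eq_abs, mul_div_right_comm, abs_mul, abs_of_nonneg hC0, sub_div,
      div_self (hω k).ne']
    exact mul_le_mul_of_nonneg_left (hC _) (abs_nonneg _)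
  have o3 : Tendsto (fun n => ω n * D n / ∑ k ∈ Finset.range n, ω k) atTop (𝓝 0) := by
    refine squeeze_zero_norm (fun n => ?_) ((tendsto_const_nhds (x := C' * C)).div_atTop hsum)
    have hs0 : 0 ≤ ∑ k ∈ Finset.range n, ω k := Finset.sum_nonneg fun k _ => (hω k).le
    rw [Real.norm_eq_abs, abs_div, abs_of_nonneg hs0, abs_mul, abs_of_pos (hω n)]
    refine div_le_div_of_nonneg_right ?_ hs0
    exact mul_le_mul (hC' n) (hC n) (abs_nonneg _) ((hω n).le.trans (hC' n))
  have id : ∀ n, ∑ k ∈ Finset.range n, e k = t * m * (∑ k ∈ Finset.range n, ω k) +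
      ∑ k ∈ Finset.range n, (e k - t * π k * ω k) +
      t * (∑ k ∈ Finset.range n, (ω k - ω (k + 1)) * D (k + 1)) + t * (ω n * D n) := by
    intro n
    induction n with
    | zero => simp [D]
    | succ n ih =>
      have : D (n + 1) = D n + (π n - m) := Finset.sum_range_succ _ _
      simp only [Finset.sum_range_succ, ih, this]
      ring
  have fin := (((tendsto_const_nhds (x := t * m)).add o1.tendsto_div_nhds_zero).add
    (o2.tendsto_div_nhds_zero.const_mul t)).add (o3.const_mul t)
  simp only [mul_zero, add_zero] at fin
  refine fin.congr' ?_
  filter_upwards [hsum.eventually_gt_atTop 0] with n hn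
  rw [id n]
  field_simp

/-- divergence along a residue class -/
lemma aux_diverge (N : ℕ) (hN : 1 ≤ N) (c : ℕ → ℝ) (hc : ∀ n, 0 < c n) (C : ℝ)
    (hC : ∀ n, c (n + 1) ≤ C * c n)
    (hdiv : Tendsto (fun m => ∑ n ∈ Finset.range m, c n) atTop atTop) (j : ℕ) :
    Tendsto (fun m => ∑ k ∈ Finset.range m, c (k * N + j)) atTop atTop := by
  by_contra hnot
  have hs : Summable fun k => c (k * N + j) := by
    by_contra h
    exact hnot ((not_summable_iff_tendsto_nat_atTop_of_nonneg (fun k => (hc _).le)).1 h)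
  have hs' : ∀ i, Summable fun k => c (k * N + (j + i)) := by
    intro i
    induction i with
    | zero => simpa using hs
    | succ i ih =>
      refine Summable.of_nonneg_of_le (fun k => (hc _).le) (fun k => ?_) (ih.mul_left C)
      exact hC (k * N + (j + i))
  have : NeZero N := ⟨by omega⟩
  have h1 : Summable fun n => c (n + j) := by
    rw [← (Nat.divModEquiv N).symm.summable_iff]
    refine (summable_prod_of_nonneg (fun _ => (hc _).le)).2 ?_
    constructor
    · intro k; exact Summable.of_finite
    · simp only [tsum_fintype]
      refine summable_sum fun i _ => ?_
      refine (hs' i).congr fun k => ?_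
      simp [Nat.divModEquiv]
      congr 1
      ring
  exact (not_summable_iff_tendsto_nat_atTop_of_nonneg (fun k => (hc k).le)).2 hdiv
    ((summable_nat_add_iff j).1 h1)


/-- one Möbius step -/
noncomputable def mstep (a b : ℕ → ℝ) (z : ℂ) (n : ℕ) (w : ℂ) : ℂ :=
  (z - b (n + 1) - a n / w) / a (n + 1)

noncomputable def morb (a b : ℕ → ℝ) (z : ℂ) (n : ℕ) (q : ℂ) : ℕ → ℂ
  | 0 => q
  | m + 1 => mstep a b z (n + m) (morb a b z n q m)

/-- hyperbolic discrepancy -/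
noncomputable def hdel (w q : ℂ) : ℝ := ‖w - q‖ ^ 2 / (w.im * q.im)

lemma mstep_im (a b : ℕ → ℝ) (z : ℂ) (n : ℕ) (w : ℂ) :
    (mstep a b z n w).im = (z.im + a n * w.im / ‖w‖ ^ 2) / a (n + 1) := by
  unfold mstep
  rw [Complex.div_ofReal_im, Complex.sub_im, Complex.sub_im, Complex.ofReal_im, div_eq_mul_inv _ w,
    Complex.im_ofReal_mul, Complex.inv_im, Complex.normSq_eq_norm_sq]
  ring

lemma mstep_im_pos (a b : ℕ → ℝ) (ha : ∀ n, 0 < a n) (z : ℂ) (hz : 0 < z.im) (n : ℕ) (w : ℂ)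
    (hw : 0 < w.im) : 0 < (mstep a b z n w).im := by
  rw [mstep_im]
  have := ha n
  have := ha (n + 1)
  positivity

lemma morb_im_pos (a b : ℕ → ℝ) (ha : ∀ n, 0 < a n) (z : ℂ) (hz : 0 < z.im) (n : ℕ) (w : ℂ)
    (hw : 0 < w.im) (m : ℕ) : 0 < (morb a b z n w m).im := by
  induction m with
  | zero => exact hw
  | succ m ih => exact mstep_im_pos a b ha z hz _ _ ih

lemma hdel_nonneg {w q : ℂ} (hw : 0 < w.im) (hq : 0 < q.im) : 0 ≤ hdel w q := by
  unfold hdel; positivity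

lemma ne_zero_of_im_pos {w : ℂ} (hw : 0 < w.im) : w ≠ 0 := by
  rintro rfl; simp at hw

lemma hdel_step (a b : ℕ → ℝ) (ha : ∀ n, 0 < a n) (z : ℂ) (hz : 0 < z.im) (n : ℕ) (w q : ℂ)
    (hw : 0 < w.im) (hq : 0 < q.im) :
    hdel (mstep a b z n w) (mstep a b z n q) ≤
      hdel w q * (1 - z.im / (a (n + 1) * (mstep a b z n q).im)) := by
  have h1 := mstep_im_pos a b ha z hz n w hw
  have h2 := mstep_im_pos a b ha z hz n q hq
  have e1 := mstep_im a b z n w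
  have e2 := mstep_im a b z n q
  have hw0 := ne_zero_of_im_pos hw
  have hq0 := ne_zero_of_im_pos hq
  have a0 := ha n
  have a1 := ha (n + 1)
  have nw : 0 < ‖w‖ := norm_pos_iff.2 hw0
  have nq : 0 < ‖q‖ := norm_pos_iff.2 hq0
  have ed : mstep a b z n w - mstep a b z n q = (a n : ℂ) * (w - q) / (a (n + 1) * (w * q)) := by
    unfold mstep
    have : (a (n + 1) : ℂ) ≠ 0 := by exact_mod_cast a1.ne'
    field_simp
    ring
  have en : ‖mstep a b z n w - mstep a b z n q‖ = a n * ‖w - q‖ / (a (n + 1) * (‖w‖ * ‖q‖)) := by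
    rw [ed, norm_div, norm_mul, norm_mul, norm_mul, Complex.norm_real, Complex.norm_real,
      Real.norm_of_nonneg a0.le, Real.norm_of_nonneg a1.le]
  unfold hdel
  rw [en]
  set W := (mstep a b z n w).im
  set Q := (mstep a b z n q).im
  rw [eq_div_iff a1.ne'] at e1 e2
  have e3 : 1 - z.im / (a (n + 1) * Q) = a n * q.im / ‖q‖ ^ 2 / (a (n + 1) * Q) := by
    rw [eq_div_iff (by positivity), sub_mul, div_mul_cancel₀ _ (by positivity)]
    linarith
  have e4 : a n * w.im ≤ a (n + 1) * W * ‖w‖ ^ 2 := by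
    have : a n * w.im / ‖w‖ ^ 2 ≤ a (n + 1) * W := by linarith
    rwa [div_le_iff₀ (by positivity)] at this
  rw [e3]
  have : (a n * ‖w - q‖ / (a (n + 1) * (‖w‖ * ‖q‖))) ^ 2 / (W * Q) =
      (‖w - q‖ ^ 2 * a n / (‖q‖ ^ 2 * Q * a (n + 1) * w.im)) *
        (a n * w.im / (a (n + 1) * W * ‖w‖ ^ 2)) := by
    field_simp
  rw [this]
  have r : ‖w - q‖ ^ 2 / (w.im * q.im) * (a n * q.im / ‖q‖ ^ 2 / (a (n + 1) * Q)) =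
      (‖w - q‖ ^ 2 * a n / (‖q‖ ^ 2 * Q * a (n + 1) * w.im)) := by
    field_simp
  rw [r]
  refine mul_le_of_le_one_right (by positivity) ?_
  rw [div_le_one (by positivity)]
  exact e4

lemma hdel_orb (a b : ℕ → ℝ) (ha : ∀ n, 0 < a n) (z : ℂ) (hz : 0 < z.im) (n : ℕ) (w q : ℂ)
    (hw : 0 < w.im) (hq : 0 < q.im) (m : ℕ) :
    hdel (morb a b z n w m) (morb a b z n q m) ≤ hdel w q := by
  induction m with
  | zero => exact le_rfl
  | succ m ih =>
    have h1 := morb_im_pos a b ha z hz n w hw m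
    have h2 := morb_im_pos a b ha z hz n q hq m
    refine (hdel_step a b ha z hz (n + m) _ _ h1 h2).trans (le_trans ?_ ih)
    refine mul_le_of_le_one_right (hdel_nonneg h1 h2) ?_
    have := mstep_im_pos a b ha z hz (n + m) _ h2
    have := ha (n + m + 1)
    rw [sub_le_self_iff]; positivity

lemma hdel_block (a b : ℕ → ℝ) (ha : ∀ n, 0 < a n) (z : ℂ) (hz : 0 < z.im) (n : ℕ) (w q : ℂ)
    (hw : 0 < w.im) (hq : 0 < q.im) (N : ℕ) (hN : 1 ≤ N) (hfix : morb a b z n q N = q) :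
    hdel (morb a b z n w N) q ≤ hdel w q * (1 - z.im / (a (n + N) * q.im)) ∧
      z.im / (a (n + N) * q.im) ≤ 1 := by
  obtain ⟨m, rfl⟩ : ∃ m, N = m + 1 := ⟨N - 1, by omega⟩
  have h1 := morb_im_pos a b ha z hz n w hw m
  have h2 := morb_im_pos a b ha z hz n q hq m
  have h3 := hdel_step a b ha z hz (n + m) _ _ h1 h2
  have e : mstep a b z (n + m) (morb a b z n q m) = q := hfix
  rw [e] at h3
  have h4 := mstep_im a b z (n + m) (morb a b z n q m)
  rw [e] at h4
  have a1 := ha (n + m + 1)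
  have a0 := ha (n + m)
  rw [eq_div_iff a1.ne'] at h4
  have h5 : z.im / (a (n + (m + 1)) * q.im) ≤ 1 := by
    rw [← add_assoc, div_le_one (by positivity)]
    have : 0 ≤ a (n + m) * (morb a b z n q m).im / ‖morb a b z n q m‖ ^ 2 := by positivity
    linarith
  refine ⟨h3.trans ?_, h5⟩
  exact mul_le_mul_of_nonneg_right (hdel_orb a b ha z hz n w q hw hq m) (by
    rw [sub_nonneg]; exact h5)

/-- perturbation of the centre -/
lemma hdel_perturb (w q q' : ℂ) (m : ℝ) (hm : 0 < m) (hw : 0 < w.im) (hq : m ≤ q.im)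
    (hq' : m ≤ q'.im) :
    Real.sqrt (hdel w q') ≤ (1 + 3 / m * ‖q' - q‖) * Real.sqrt (hdel w q) + 3 / m * ‖q' - q‖ := by
  have hq0 : 0 < q.im := hm.trans_le hq
  have hq0' : 0 < q'.im := hm.trans_le hq'
  have sq : ∀ q : ℂ, 0 < q.im → Real.sqrt (hdel w q) = ‖w - q‖ / (√w.im * √q.im) := by
    intro q hq
    unfold hdel
    rw [Real.sqrt_div (by positivity), Real.sqrt_sq (norm_nonneg _), Real.sqrt_mul hw.le]
  set e := ‖q' - q‖ with he
  have he0 : 0 ≤ e := norm_nonneg _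
  set u := Real.sqrt (hdel w q) with hu
  have hu0 : 0 ≤ u := Real.sqrt_nonneg _
  have hu1 : u * (√w.im * √q.im) = ‖w - q‖ := by
    rw [hu, sq q hq0, div_mul_cancel₀]; positivity
  have tri : ‖w - q'‖ ≤ ‖w - q‖ + e := by
    calc ‖w - q'‖ = ‖(w - q) - (q' - q)‖ := by congr 1; ring
      _ ≤ _ := norm_sub_le _ _
  have him : |q'.im - q.im| ≤ e := by
    rw [← Complex.sub_im]; exact Complex.abs_im_le_norm _
  have himw : |w.im - q.im| ≤ ‖w - q‖ := by
    rw [← Complex.sub_im]; exact Complex.abs_im_le_norm _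
  rw [abs_le] at him himw
  have sm : 0 < √m := Real.sqrt_pos.2 hm
  have sw : 0 < √w.im := Real.sqrt_pos.2 hw
  have smm : √m * √m = m := Real.mul_self_sqrt hm.le
  have sww : √w.im * √w.im = w.im := Real.mul_self_sqrt hw.le
  have sqq : √q.im * √q.im = q.im := Real.mul_self_sqrt hq0.le
  have sqm : √m ≤ √q.im := Real.sqrt_le_sqrt hq
  have sqm' : √m ≤ √q'.im := Real.sqrt_le_sqrt hq'
  have r1 : √q.im ≤ (1 + e / m) * √q'.im := by
    have : q.im ≤ (1 + e / m) ^ 2 * q'.im := by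
      have h1 : e ≤ e / m * q'.im := by
        rw [div_mul_eq_mul_div, le_div_iff₀ hm]; exact mul_le_mul_of_nonneg_left hq' he0
      have h2 : 0 ≤ e / m := by positivity
      have h3 := mul_nonneg (mul_nonneg h2 h2) hq0'.le
      nlinarith [mul_nonneg h2 hq0'.le]
    calc √q.im ≤ √((1 + e / m) ^ 2 * q'.im) := Real.sqrt_le_sqrt this
      _ = _ := by rw [Real.sqrt_mul (by positivity), Real.sqrt_sq (by positivity)]
  have r2 : √m ≤ (2 * u + 2) * √w.im := by
    rcases le_or_gt (q.im / 2) w.im with h | h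
    · have : √m ≤ 2 * √w.im := by
        rw [show (2 : ℝ) = √4 by rw [show (4:ℝ) = 2 ^ 2 by norm_num]; simp, ← Real.sqrt_mul (by norm_num)]
        exact Real.sqrt_le_sqrt (by linarith)
      nlinarith [mul_nonneg hu0 sw.le]
    · have h1 : q.im / 2 ≤ u * (√w.im * √q.im) := by rw [hu1]; linarith
      have h2 : √q.im ≤ 2 * u * √w.im := by
        have h3 : 0 < √q.im := sm.trans_le sqm
        by_contra hcon
        nlinarith
      nlinarith [mul_nonneg hu0 sw.le]
  rw [sq q' hq0']
  have sq' : 0 < √q'.im := sm.trans_le sqm'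
  rw [div_le_iff₀ (by positivity)]
  have f1 : ‖w - q‖ ≤ u * (1 + e / m) * (√w.im * √q'.im) := by
    rw [← hu1]
    nlinarith [mul_le_mul_of_nonneg_left r1 (mul_nonneg hu0 sw.le)]
  have f2 : e ≤ e / m * (2 * u + 2) * (√w.im * √q'.im) := by
    have h5 : m ≤ (2 * u + 2) * √w.im * √q'.im := by
      rw [← smm]
      exact mul_le_mul r2 sqm' sm.le (by positivity)
    calc e = e / m * m := by field_simp
      _ ≤ e / m * ((2 * u + 2) * √w.im * √q'.im) := mul_le_mul_of_nonneg_left h5 (by positivity)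
      _ = _ := by ring
  have h6 : 0 ≤ e / m * (√w.im * √q'.im) := by positivity
  calc ‖w - q'‖ ≤ u * (1 + e / m) * (√w.im * √q'.im) + e / m * (2 * u + 2) * (√w.im * √q'.im) := by
        linarith
    _ ≤ u * (1 + e / m) * (√w.im * √q'.im) + e / m * (2 * u + 3) * (√w.im * √q'.im) := by
        nlinarith
    _ = _ := by ring

lemma hdel_tendsto (w q : ℕ → ℂ) (M : ℝ) (hw : ∀ k, 0 < (w k).im) (hq : ∀ k, 0 < (q k).im)
    (hM : ∀ k, (q k).im ≤ M) (h : Tendsto (fun k => Real.sqrt (hdel (w k) (q k))) atTop (𝓝 0)) :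
    Tendsto (fun k => w k - q k) atTop (𝓝 0) := by
  have h2 : Tendsto (fun k => hdel (w k) (q k)) atTop (𝓝 0) := by
    have := h.pow 2
    simp only [ne_eq, OfNat.ofNat_ne_zero, not_false_eq_true, zero_pow] at this
    exact this.congr fun k => Real.sq_sqrt (hdel_nonneg (hw k) (hq k))
  have h3 : Tendsto (fun k => Real.sqrt (2 * M ^ 2 * hdel (w k) (q k) + M ^ 2 * (hdel (w k) (q k)) ^ 2))
      atTop (𝓝 0) := by
    have := ((h2.const_mul (2 * M ^ 2)).add ((h2.pow 2).const_mul (M ^ 2))).sqrt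
    simpa using this
  refine squeeze_zero_norm (fun k => ?_) h3
  apply Real.le_sqrt_of_sq_le
  set d := hdel (w k) (q k) with hd
  have hd0 : 0 ≤ d := hdel_nonneg (hw k) (hq k)
  set x := ‖w k - q k‖ with hx
  have e : x ^ 2 = d * ((w k).im * (q k).im) := by
    rw [hd]; unfold hdel
    have := hw k
    have := hq k
    field_simp
    rw [hx]
  have him : |(w k).im - (q k).im| ≤ x := by
    rw [← Complex.sub_im]; exact Complex.abs_im_le_norm _
  rw [abs_le] at him
  have hx0 : 0 ≤ x := norm_nonneg _
  have hM0 : 0 ≤ M := (hq k).le.trans (hM k)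
  have : (w k).im * (q k).im ≤ (M + x) * M :=
    mul_le_mul (by linarith [hM k]) (hM k) (hq k).le (by linarith)
  have e2 : x ^ 2 ≤ d * ((M + x) * M) := e ▸ mul_le_mul_of_nonneg_left this hd0
  nlinarith [sq_nonneg (d * M - x)]


def tp {R : Type*} [Monoid R] (A : ℕ → R) (n : ℕ) : ℕ → R
  | 0 => 1
  | m + 1 => A (n + m) * tp A n m

lemma tp_add {R : Type*} [Monoid R] (A : ℕ → R) (n m k : ℕ) :
    tp A n (m + k) = tp A (n + m) k * tp A n m := by
  induction k with
  | zero => simp [tp]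
  | succ k ih =>
    rw [← add_assoc]
    simp only [tp]
    rw [ih, mul_assoc, add_assoc]

lemma tp_periodic {R : Type*} [Monoid R] (A : ℕ → R) (N : ℕ) (h : ∀ k, A (k + N) = A k) (n m : ℕ) :
    tp A (n + N) m = tp A n m := by
  induction m with
  | zero => rfl
  | succ m ih =>
    simp only [tp]
    rw [ih, show n + N + m = n + m + N by ring, h]

lemma tp_periodic' {R : Type*} [Monoid R] (A : ℕ → R) (N : ℕ) (h : ∀ k, A (k + N) = A k)
    (n m k : ℕ) : tp A (k * N + n) m = tp A n m := by
  induction k with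
  | zero => simp
  | succ k ih =>
    rw [← ih, ← tp_periodic A N h (k * N + n)]
    congr 1
    ring

lemma tp_list {R : Type*} [Monoid R] (A : ℕ → R) (n m : ℕ) :
    (((List.range m).map (fun k => A (n + k))).reverse).prod = tp A n m := by
  induction m with
  | zero => simp [tp]
  | succ m ih => simp [List.range_succ, tp, ih]

/-- sequences close to a bounded one and of bounded `N`-variation -/
def GoodSeq {R : Type*} [NormedRing R] (N : ℕ) (A L : ℕ → R) : Prop :=
  (∃ C, ∀ n, ‖A n‖ ≤ C) ∧ (∃ C, ∀ n, ‖L n‖ ≤ C) ∧ Tendsto (fun n => A n - L n) atTop (𝓝 0) ∧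
    Summable fun n => ‖A (n + N) - A n‖

lemma GoodSeq.shift {R : Type*} [NormedRing R] {N : ℕ} {A L : ℕ → R} (h : GoodSeq N A L) (m : ℕ) :
    GoodSeq N (fun n => A (n + m)) (fun n => L (n + m)) := by
  obtain ⟨⟨C, hC⟩, ⟨C', hC'⟩, h1, h2⟩ := h
  refine ⟨⟨C, fun n => hC _⟩, ⟨C', fun n => hC' _⟩, h1.comp (tendsto_add_atTop_nat m), ?_⟩
  refine ((summable_nat_add_iff m).2 h2).congr fun n => ?_
  rw [show n + m + N = n + N + m by ring]

lemma GoodSeq.mul {R : Type*} [NormedRing R] {N : ℕ} {A L B K : ℕ → R} (h : GoodSeq N A L)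
    (h' : GoodSeq N B K) : GoodSeq N (fun n => A n * B n) (fun n => L n * K n) := by
  obtain ⟨⟨C, hC⟩, ⟨C', hC'⟩, h1, h2⟩ := h
  obtain ⟨⟨D, hD⟩, ⟨D', hD'⟩, k1, k2⟩ := h'
  have hC0 := (norm_nonneg _).trans (hC 0)
  have hC0' := (norm_nonneg _).trans (hC' 0)
  have hD0 := (norm_nonneg _).trans (hD 0)
  refine ⟨⟨C * D, fun n => (norm_mul_le _ _).trans (mul_le_mul (hC n) (hD n) (norm_nonneg _) hC0)⟩,
    ⟨C' * D', fun n => (norm_mul_le _ _).trans (mul_le_mul (hC' n) (hD' n) (norm_nonneg _) hC0')⟩,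
    ?_, ?_⟩
  · have : Tendsto (fun n => C * ‖B n - K n‖ + ‖A n - L n‖ * D') atTop (𝓝 0) := by
      simpa using (k1.norm.const_mul C).add (h1.norm.mul_const D')
    refine squeeze_zero_norm (fun n => ?_) this
    calc ‖A n * B n - L n * K n‖ = ‖A n * (B n - K n) + (A n - L n) * K n‖ := by
          congr 1; noncomm_ring
      _ ≤ ‖A n * (B n - K n)‖ + ‖(A n - L n) * K n‖ := norm_add_le _ _
      _ ≤ _ := add_le_add
        ((norm_mul_le _ _).trans (mul_le_mul_of_nonneg_right (hC n) (norm_nonneg _)))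
        ((norm_mul_le _ _).trans (mul_le_mul_of_nonneg_left (hD' n) (norm_nonneg _)))
  · refine Summable.of_nonneg_of_le (fun _ => norm_nonneg _) (fun n => ?_)
      ((k2.mul_left C).add (h2.mul_right D))
    calc ‖A (n + N) * B (n + N) - A n * B n‖ =
          ‖A (n + N) * (B (n + N) - B n) + (A (n + N) - A n) * B n‖ := by
          congr 1; noncomm_ring
      _ ≤ ‖A (n + N) * (B (n + N) - B n)‖ + ‖(A (n + N) - A n) * B n‖ := norm_add_le _ _
      _ ≤ _ := add_le_add
        ((norm_mul_le _ _).trans (mul_le_mul_of_nonneg_right (hC _) (norm_nonneg _)))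
        ((norm_mul_le _ _).trans (mul_le_mul_of_nonneg_left (hD n) (norm_nonneg _)))

lemma GoodSeq.tp {R : Type*} [NormedRing R] {N : ℕ} {A L : ℕ → R} (h : GoodSeq N A L) (m : ℕ) :
    GoodSeq N (fun n => tp A n m) (fun n => tp L n m) := by
  induction m with
  | zero =>
    refine ⟨⟨‖(1 : R)‖, fun n => le_rfl⟩, ⟨‖(1 : R)‖, fun n => le_rfl⟩, ?_, ?_⟩
    · simp [_root_.tp]
    · simp [_root_.tp]
  | succ m ih => exact (h.shift m).mul ih

section mat
attribute [local instance] Matrix.linftyOpNormedRing Matrix.linftyOpNormedAlgebra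

abbrev Mat2 := Matrix (Fin 2) (Fin 2) ℂ

lemma norm_mat2_le (M : Mat2) : ‖M‖ ≤ ‖M 0 0‖ + ‖M 0 1‖ + ‖M 1 0‖ + ‖M 1 1‖ := by
  rw [Matrix.linfty_opNorm_def]
  have : (Finset.univ.sup fun i : Fin 2 => ∑ j : Fin 2, ‖M i j‖₊) ≤
      ‖M 0 0‖₊ + ‖M 0 1‖₊ + ‖M 1 0‖₊ + ‖M 1 1‖₊ := by
    refine Finset.sup_le fun i _ => ?_
    fin_cases i
    · simp only [Fin.sum_univ_two]
      simp only [Fin.zero_eta]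
      rw [add_assoc]
      exact le_self_add
    · simp only [Fin.sum_univ_two]
      rw [add_assoc]
      exact le_add_self
  exact_mod_cast this

/-- the attracting fixed point as a function of the matrix -/
noncomputable def fixpt (σ : ℝ) (M : Mat2) : ℂ :=
  (M 1 1 - M 0 0 + σ * Complex.I *
    Complex.exp (Complex.log (4 * (M 0 0 * M 1 1 - M 0 1 * M 1 0) - (M 0 0 + M 1 1) ^ 2) / 2)) /
    (2 * M 0 1)

lemma contDiff_entry (i j : Fin 2) : ContDiff ℂ 1 (fun M : Mat2 => M i j) :=
  (LinearMap.toContinuousLinearMap (Matrix.entryLinearMap ℂ ℂ i j)).contDiff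

lemma fixpt_fixed (σ : ℝ) (hσ : σ ^ 2 = 1) (M : Mat2) (h : M 0 1 ≠ 0)
    (h' : 4 * (M 0 0 * M 1 1 - M 0 1 * M 1 0) - (M 0 0 + M 1 1) ^ 2 ≠ 0) :
    M 1 0 + M 1 1 * fixpt σ M = (M 0 0 + M 0 1 * fixpt σ M) * fixpt σ M := by
  have e : (Complex.exp (Complex.log (4 * (M 0 0 * M 1 1 - M 0 1 * M 1 0) -
      (M 0 0 + M 1 1) ^ 2) / 2)) ^ 2 = 4 * (M 0 0 * M 1 1 - M 0 1 * M 1 0) -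
      (M 0 0 + M 1 1) ^ 2 := by
    rw [← Complex.exp_nat_mul]
    push_cast
    rw [mul_div_cancel₀ _ two_ne_zero, Complex.exp_log h']
  have hs : (σ : ℂ) ^ 2 = 1 := by exact_mod_cast hσ
  unfold fixpt
  set E := Complex.exp (Complex.log (4 * (M 0 0 * M 1 1 - M 0 1 * M 1 0) -
      (M 0 0 + M 1 1) ^ 2) / 2)
  field_simp
  linear_combination (-Complex.I ^ 2 * E ^ 2) * hs - Complex.I ^ 2 * e -
    (4 * (M 0 0 * M 1 1 - M 0 1 * M 1 0) - (M 0 0 + M 1 1) ^ 2) * Complex.I_sq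

lemma exists_fixseq (M : ℕ → Mat2) (R : Mat2) (hM : Tendsto M atTop (𝓝 R))
    (hs : Summable fun k => ‖M (k + 1) - M k‖) (A B C D τ : ℝ)
    (hA : R 0 0 = A) (hB : R 0 1 = B) (hC : R 1 0 = C) (hD : R 1 1 = D)
    (hdet : A * D - B * C = 1) (htr : A + D = τ) (hτ : τ ^ 2 < 4) (hB0 : B ≠ 0) :
    ∃ (q : ℕ → ℂ) (ql : ℂ), Tendsto q atTop (𝓝 ql) ∧ ql.im = √(4 - τ ^ 2) / (2 * |B|) ∧
      (Summable fun k => ‖q (k + 1) - q k‖) ∧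
      ∀ᶠ k in atTop, M k 1 0 + M k 1 1 * q k = (M k 0 0 + M k 0 1 * q k) * q k := by
  set σ : ℝ := B / |B| with hσd
  have habs : |B| ≠ 0 := abs_ne_zero.2 hB0
  have hσ : σ ^ 2 = 1 := by rw [hσd, div_pow, sq_abs, div_self (pow_ne_zero 2 hB0)]
  have hdis : 4 * (R 0 0 * R 1 1 - R 0 1 * R 1 0) - (R 0 0 + R 1 1) ^ 2 = ((4 - τ ^ 2 : ℝ) : ℂ) := by
    rw [hA, hB, hC, hD, ← htr]
    rw [show (4 : ℝ) - (A + D) ^ 2 = 4 * (A * D - B * C) - (A + D) ^ 2 by rw [hdet]; ring]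
    push_cast
    ring
  have hpos : 0 < 4 - τ ^ 2 := by linarith
  have hcd : ContDiffAt ℂ 1 (fixpt σ) R := by
    unfold fixpt
    have c := fun i j => (contDiff_entry i j).contDiffAt (x := R)
    refine ContDiffAt.div ?_ (contDiffAt_const.mul (c 0 1)) ?_
    · refine ((c 1 1).sub (c 0 0)).add (contDiffAt_const.mul (ContDiffAt.cexp ?_))
      refine ContDiffAt.div_const ?_ _
      refine ContDiffAt.comp R (Complex.contDiffAt_log ?_) ?_
      swap
      · exact (contDiffAt_const.mul (((c 0 0).mul (c 1 1)).sub ((c 0 1).mul (c 1 0)))).sub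
          (((c 0 0).add (c 1 1)).pow 2)
      · rw [hdis]
        exact Complex.ofReal_mem_slitPlane.2 hpos
    · rw [hB]
      simpa using hB0
  obtain ⟨K, s, hsn, hlip⟩ := hcd.exists_lipschitzOnWith
  refine ⟨fun k => fixpt σ (M k), fixpt σ R, hcd.continuousAt.tendsto.comp hM, ?_, ?_, ?_⟩
  · unfold fixpt
    rw [hdis, ← Complex.ofReal_log hpos.le, hA, hB, hD]
    rw [show (Complex.exp ((Real.log (4 - τ ^ 2) : ℝ) / 2 : ℂ)) = ((√(4 - τ ^ 2) : ℝ) : ℂ) by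
      rw [Real.sqrt_eq_rpow, Real.rpow_def_of_pos hpos]
      push_cast
      congr 1; ring]
    rw [show ((2 : ℂ) * (B : ℂ)) = ((2 * B : ℝ) : ℂ) by push_cast; ring, Complex.div_ofReal_im]
    simp only [Complex.add_im, Complex.sub_im, Complex.ofReal_im, Complex.mul_im, Complex.mul_re,
      Complex.I_re, Complex.I_im, Complex.ofReal_re]
    rw [hσd]
    field_simp
    simp
  · have h1 : ∀ᶠ k in atTop, M k ∈ s := hM hsn
    have h2 : ∀ᶠ k in atTop, M (k + 1) ∈ s := (hM.comp (tendsto_add_atTop_nat 1)) hsn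
    have h3 : Summable fun k => fixpt σ (M (k + 1)) - fixpt σ (M k) := by
      refine Summable.of_norm_bounded_eventually_nat (hs.mul_left (K : ℝ)) ?_
      filter_upwards [h1, h2] with k hk1 hk2
      exact hlip.norm_sub_le hk2 hk1
    exact h3.norm
  · have c := fun i j => ((contDiff_entry i j).continuous.tendsto R).comp hM
    have h1 : ∀ᶠ k in atTop, M k 0 1 ≠ 0 :=
      (c 0 1).eventually_ne (by rw [hB]; simpa using hB0)
    have h2 : ∀ᶠ k in atTop, 4 * (M k 0 0 * M k 1 1 - M k 0 1 * M k 1 0) -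
        (M k 0 0 + M k 1 1) ^ 2 ≠ 0 := by
      have := ((((c 0 0).mul (c 1 1)).sub ((c 0 1).mul (c 1 0))).const_mul 4).sub
        (((c 0 0).add (c 1 1)).pow 2)
      refine this.eventually_ne ?_
      rw [hdis]
      exact_mod_cast hpos.ne'
    filter_upwards [h1, h2] with k hk1 hk2
    exact fixpt_fixed σ hσ (M k) hk1 hk2

end mat


/-- the one-step transfer matrix (index shifted by one) -/
noncomputable def Amat (a b : ℕ → ℝ) (z : ℂ) (n : ℕ) : Mat2 :=
  !![0, 1; -((a n : ℂ) / a (n + 1)), (z - b (n + 1)) / a (n + 1)]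

lemma tp_morb (a b : ℕ → ℝ) (ha : ∀ n, 0 < a n) (z : ℂ) (hz : 0 < z.im) (n : ℕ) (q : ℂ)
    (hq : 0 < q.im) (m : ℕ) : ∃ c : ℂ, c ≠ 0 ∧
      (tp (Amat a b z) n m) 0 0 + (tp (Amat a b z) n m) 0 1 * q = c ∧
      (tp (Amat a b z) n m) 1 0 + (tp (Amat a b z) n m) 1 1 * q = c * morb a b z n q m := by
  induction m with
  | zero => exact ⟨1, one_ne_zero, by simp [tp], by simp [tp, morb]⟩
  | succ m ih =>
    obtain ⟨c, hc, h1, h2⟩ := ih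
    have hne := ne_zero_of_im_pos (morb_im_pos a b ha z hz n q hq m)
    refine ⟨c * morb a b z n q m, mul_ne_zero hc hne, ?_, ?_⟩
    · rw [← h2]
      simp [tp, Amat, Matrix.mul_apply, Fin.sum_univ_two]
    · have ha0 : (a (n + m + 1) : ℂ) ≠ 0 := by exact_mod_cast (ha _).ne'
      have e : c * morb a b z n q m * morb a b z n q (m + 1) =
          -((a (n + m) : ℂ) / a (n + m + 1)) * c +
          (z - b (n + m + 1)) / a (n + m + 1) * (c * morb a b z n q m) := by
        simp only [morb, mstep]
        field_simp
        ring
      rw [e, ← h2, ← h1]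
      simp only [tp, Amat, Matrix.mul_apply, Fin.sum_univ_two, Matrix.cons_val', Matrix.cons_val_zero,
        Matrix.cons_val_one, Matrix.of_apply]
      ring

lemma morb_fixed (a b : ℕ → ℝ) (ha : ∀ n, 0 < a n) (z : ℂ) (hz : 0 < z.im) (n : ℕ) (q : ℂ)
    (hq : 0 < q.im) (N : ℕ)
    (h : (tp (Amat a b z) n N) 1 0 + (tp (Amat a b z) n N) 1 1 * q =
      ((tp (Amat a b z) n N) 0 0 + (tp (Amat a b z) n N) 0 1 * q) * q) : morb a b z n q N = q := by
  obtain ⟨c, hc, h1, h2⟩ := tp_morb a b ha z hz n q hq N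
  rw [h1, h2] at h
  exact mul_left_cancel₀ hc h

noncomputable def Wseq (a b : ℕ → ℝ) (z : ℂ) : ℕ → ℂ
  | 0 => (z - b 0) / a 0
  | n + 1 => mstep a b z n (Wseq a b z n)

lemma Wseq_im_pos (a b : ℕ → ℝ) (ha : ∀ n, 0 < a n) (z : ℂ) (hz : 0 < z.im) (n : ℕ) :
    0 < (Wseq a b z n).im := by
  induction n with
  | zero =>
    simp only [Wseq]
    rw [Complex.div_ofReal_im, Complex.sub_im, Complex.ofReal_im, sub_zero]
    exact div_pos hz (ha 0)
  | succ n ih => exact mstep_im_pos a b ha z hz n _ ih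

lemma Wseq_morb (a b : ℕ → ℝ) (z : ℂ) (n m : ℕ) :
    Wseq a b z (n + m) = morb a b z n (Wseq a b z n) m := by
  induction m with
  | zero => rfl
  | succ m ih => rw [← add_assoc]; simp only [Wseq, morb]; rw [ih]

section mat2
attribute [local instance] Matrix.linftyOpNormedRing Matrix.linftyOpNormedAlgebra

set_option maxHeartbeats 2000000 in
lemma Wseq_class (a b : ℕ → ℝ) (ha : ∀ n, 0 < a n) (N : ℕ) (hN : 1 ≤ N) (z : ℂ) (hz : 0 < z.im)
    (L : ℕ → Mat2) (hLper : ∀ k, L (k + N) = L k) (hgood : GoodSeq N (Amat a b z) L)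
    (j : ℕ) (hdiv : Tendsto (fun m => ∑ k ∈ Finset.range m, 1 / a (k * N + j)) atTop atTop)
    (A B C D τ : ℝ)
    (hA : (tp L j N) 0 0 = A) (hB : (tp L j N) 0 1 = B) (hC : (tp L j N) 1 0 = C)
    (hD : (tp L j N) 1 1 = D)
    (hdet : A * D - B * C = 1) (htr : A + D = τ) (hτ : τ ^ 2 < 4) (hB0 : B ≠ 0) :
    Tendsto (fun k => (Wseq a b z (k * N + j)).im) atTop (𝓝 (√(4 - τ ^ 2) / (2 * |B|))) := by
  obtain ⟨-, -, g1, g2⟩ := hgood.tp N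
  have hkN : Tendsto (fun k => k * N + j) atTop atTop :=
    tendsto_atTop_mono (fun k => (Nat.le_mul_of_pos_right k (by omega)).trans (Nat.le_add_right _ _))
      tendsto_id
  have hM : Tendsto (fun k => tp (Amat a b z) (k * N + j) N) atTop (𝓝 (tp L j N)) := by
    have := g1.comp hkN
    rw [← sub_zero (tp L j N)]
    have h2 := this.add_const (tp L j N)
    rw [zero_add] at h2
    rw [sub_zero]
    refine h2.congr fun k => ?_
    simp only [Function.comp]
    rw [tp_periodic' L N hLper, sub_add_cancel]
  have hs : Summable fun k => ‖tp (Amat a b z) ((k + 1) * N + j) N - tp (Amat a b z) (k * N + j) N‖ := by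
    have hinj : Function.Injective fun k => k * N + j := by
      intro x y h
      have h : x * N = y * N := Nat.add_right_cancel h
      exact Nat.eq_of_mul_eq_mul_right (by omega) h
    refine (g2.comp_injective hinj).congr fun k => ?_
    simp only [Function.comp]
    rw [show k * N + j + N = (k + 1) * N + j by ring]
  obtain ⟨q, ql, hq, hqim, hqs, hfix⟩ := exists_fixseq (fun k => tp (Amat a b z) (k * N + j) N) _ hM hs
    A B C D τ hA hB hC hD hdet htr hτ hB0
  rw [← hqim]
  have hql : 0 < ql.im := by
    rw [hqim]
    have : 0 < 4 - τ ^ 2 := by linarith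
    positivity
  have hqi : Tendsto (fun k => (q k).im) atTop (𝓝 ql.im) := (Complex.continuous_im.tendsto _).comp hq
  obtain ⟨K, hK⟩ := eventually_atTop.1 (hfix.and
    ((hqi.eventually (lt_mem_nhds (half_lt_self hql))).and
      (hqi.eventually (gt_mem_nhds (lt_add_one ql.im)))))
  set m := ql.im / 2 with hm
  have hm0 : 0 < m := half_pos hql
  -- shifted sequences
  have key : Tendsto (fun k => Real.sqrt (hdel (Wseq a b z ((k + K) * N + j)) (q (k + K)))) atTop (𝓝 0) := by
    have hW : ∀ n, 0 < (Wseq a b z n).im := Wseq_im_pos a b ha z hz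
    have hqp : ∀ k, 0 < (q (k + K)).im := fun k => hm0.trans (hK _ (by omega)).2.1
    refine aux_scalar _ (fun k => z.im / (2 * (ql.im + 1)) * (1 / a ((k + K + 1) * N + j)))
      (fun k => 3 / m * ‖q (k + K + 1) - q (k + K)‖) (fun k => Real.sqrt_nonneg _)
      (fun k => ?_) (fun k => by positivity) ?_ ?_ ?_
    · have := ha ((k + K + 1) * N + j)
      positivity
    · exact ((summable_nat_add_iff K).2 hqs).mul_left _
    · simp_rw [← Finset.mul_sum]
      refine Tendsto.const_mul_atTop (by positivity) ?_
      have h1 : Tendsto (fun n => ∑ k ∈ Finset.range (n + (K + 1)), 1 / a (k * N + j)) atTop atTop :=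
        hdiv.comp (tendsto_add_atTop_nat (K + 1))
      have h2 := tendsto_atTop_add_const_right atTop
        (-∑ k ∈ Finset.range (K + 1), 1 / a (k * N + j)) h1
      refine h2.congr fun n => ?_
      rw [add_comm n (K + 1), Finset.sum_range_add]
      rw [add_comm, neg_add_cancel_left]
      refine Finset.sum_congr rfl fun k _ => ?_
      rw [show K + 1 + k = k + K + 1 by ring]
    · intro k
      have hf := morb_fixed a b ha z hz ((k + K) * N + j) (q (k + K)) (hqp k) N (hK (k + K) (by omega)).1
      have hb := hdel_block a b ha z hz ((k + K) * N + j) (Wseq a b z ((k + K) * N + j)) (q (k + K))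
        (hW _) (hqp k) N hN hf
      rw [← Wseq_morb, show (k + K) * N + j + N = (k + K + 1) * N + j by ring] at hb
      have hp := hdel_perturb (Wseq a b z ((k + K + 1) * N + j)) (q (k + K)) (q (k + K + 1)) m hm0
        (hW _) (hK _ (by omega)).2.1.le (hK _ (by omega)).2.1.le
      rw [show k + 1 + K = k + K + 1 by ring]
      refine hp.trans ?_
      refine add_le_add (mul_le_mul_of_nonneg_left ?_ (by positivity)) le_rfl
      have ha' := ha ((k + K + 1) * N + j)
      have hd0 := hdel_nonneg (hW ((k + K) * N + j)) (hqp k)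
      set y := z.im / (a ((k + K + 1) * N + j) * (q (k + K)).im) with hy
      have hqpk := hqp k
      have hy0 : 0 ≤ y := by positivity
      have hy1 : z.im / (2 * (ql.im + 1)) * (1 / a ((k + K + 1) * N + j)) ≤ y / 2 := by
        rw [hy, div_mul_div_comm, mul_one, div_div]
        apply div_le_div_of_nonneg_left hz.le (by positivity)
        have := mul_le_mul_of_nonneg_left (hK (k + K) (by omega)).2.2.le ha'.le
        nlinarith
      calc √(hdel (Wseq a b z ((k + K + 1) * N + j)) (q (k + K)))
          ≤ √(hdel (Wseq a b z ((k + K) * N + j)) (q (k + K)) * (1 - y)) := Real.sqrt_le_sqrt hb.1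
        _ = √(1 - y) * √(hdel (Wseq a b z ((k + K) * N + j)) (q (k + K))) := by
          rw [Real.sqrt_mul hd0, mul_comm]
        _ ≤ _ := by
          refine mul_le_mul_of_nonneg_right ?_ (Real.sqrt_nonneg _)
          have h1 : √(1 - y) ≤ 1 - y / 2 := by
            exact Real.sqrt_le_iff.2 ⟨by linarith [hb.2], by nlinarith⟩
          linarith
  have hWq := hdel_tendsto _ _ (ql.im + 1) (fun k => Wseq_im_pos a b ha z hz _)
    (fun k => hm0.trans (hK (k + K) (by omega)).2.1) (fun k => (hK (k + K) (by omega)).2.2.le) key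
  have h5 := ((Complex.continuous_im.tendsto _).comp hWq).add (hqi.comp (tendsto_add_atTop_nat K))
  simp only [Complex.zero_im, zero_add] at h5
  refine (tendsto_add_atTop_iff_nat K).1 (h5.congr fun k => ?_)
  simp [Function.comp]

end mat2


/-- real periodic one-step matrix -/
noncomputable def Rm (α β : ℕ → ℝ) (n : ℕ) : Matrix (Fin 2) (Fin 2) ℝ :=
  !![0, 1; -(α n / α (n + 1)), -(β (n + 1) / α (n + 1))]

lemma tp_map {R S : Type*} [Monoid R] [Monoid S] (f : R →* S) (A : ℕ → R) (n m : ℕ) :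
    f (tp A n m) = tp (fun k => f (A k)) n m := by
  induction m with
  | zero => simp [tp]
  | succ m ih => simp [tp, ih]

lemma tp_conj {R : Type*} [Monoid R] (A : ℕ → R) (N : ℕ) (h : ∀ k, A (k + N) = A k) (n : ℕ) :
    tp A (n + 1) N * A n = A n * tp A n N := by
  have h1 := tp_add A n 1 N
  rw [add_comm 1 N] at h1
  simp only [tp, add_zero, mul_one] at h1
  rw [← h1, h]

lemma Rm_per (N : ℕ) (α β : ℕ → ℝ) (hα : ∀ k, α (k + N) = α k) (hβ : ∀ k, β (k + N) = β k)
    (k : ℕ) : Rm α β (k + N) = Rm α β k := by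
  unfold Rm
  rw [show k + N + 1 = k + 1 + N by ring, hα, hα, hβ]

lemma Rm_det (α β : ℕ → ℝ) (hα : ∀ k, 0 < α k) (n m : ℕ) :
    (tp (Rm α β) n m).det = α n / α (n + m) := by
  induction m with
  | zero => simp [tp, (hα n).ne']
  | succ m ih =>
    simp only [tp]
    rw [Matrix.det_mul, ih, Matrix.det_fin_two]
    have h1 := (hα (n + m)).ne'
    have h2 := (hα (n + m + 1)).ne'
    simp [Rm]
    rw [← add_assoc]
    field_simp

lemma Rm_step (N : ℕ) (α β : ℕ → ℝ) (hα0 : ∀ k, 0 < α k) (hα : ∀ k, α (k + N) = α k)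
    (hβ : ∀ k, β (k + N) = β k) (n : ℕ) :
    (tp (Rm α β) (n + 1) N).trace = (tp (Rm α β) n N).trace ∧
    (tp (Rm α β) (n + 1) N) 0 1 = -((tp (Rm α β) n N) 1 0) * (α (n + 1) / α n) := by
  have h := tp_conj (Rm α β) N (Rm_per N α β hα hβ) n
  have h0 := (hα0 n).ne'
  have h1 := (hα0 (n + 1)).ne'
  have e00 := congrFun (congrFun h 0) 0
  have e01 := congrFun (congrFun h 0) 1
  have e10 := congrFun (congrFun h 1) 0
  simp [Rm, Matrix.mul_apply, Fin.sum_univ_two] at e00 e01 e10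
  rw [Matrix.trace_fin_two, Matrix.trace_fin_two]
  set P := tp (Rm α β) n N
  set Q := tp (Rm α β) (n + 1) N
  have hB : Q 0 1 = -(P 1 0) * (α (n + 1) / α n) := by
    rw [← e00]; field_simp
  refine ⟨?_, hB⟩
  have hD : Q 1 1 = P 0 0 + P 1 0 * β (n + 1) / α n := by
    field_simp at e10 ⊢
    linarith
  have hA : Q 0 0 = P 1 1 + Q 0 1 * (β (n + 1) / α (n + 1)) := by linarith
  rw [hA, hD, hB]
  field_simp
  ring

lemma Rm_facts (N : ℕ) (α β : ℕ → ℝ) (hα0 : ∀ k, 0 < α k) (hα : ∀ k, α (k + N) = α k)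
    (hβ : ∀ k, β (k + N) = β k) (τ : ℝ) (hτ : τ ^ 2 < 4) (m : ℕ)
    (hm : (tp (Rm α β) m N).trace = τ) (n : ℕ) :
    (tp (Rm α β) n N) 0 0 + (tp (Rm α β) n N) 1 1 = τ ∧
    (tp (Rm α β) n N) 0 0 * (tp (Rm α β) n N) 1 1 - (tp (Rm α β) n N) 0 1 * (tp (Rm α β) n N) 1 0 = 1 ∧
    0 < (tp (Rm α β) 0 N) 0 1 * (tp (Rm α β) n N) 0 1 := by
  have h0 : ∀ n, (tp (Rm α β) n N).trace = (tp (Rm α β) 0 N).trace := by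
    intro n
    induction n with
    | zero => rfl
    | succ n ih => rw [(Rm_step N α β hα0 hα hβ n).1, ih]
  have h1 : ∀ n, (tp (Rm α β) n N) 0 0 + (tp (Rm α β) n N) 1 1 = τ := by
    intro n
    rw [← Matrix.trace_fin_two, h0, ← h0 m, hm]
  have h2 : ∀ n, (tp (Rm α β) n N) 0 0 * (tp (Rm α β) n N) 1 1 -
      (tp (Rm α β) n N) 0 1 * (tp (Rm α β) n N) 1 0 = 1 := by
    intro n
    rw [← Matrix.det_fin_two, Rm_det α β hα0, hα, div_self (hα0 n).ne']
  have h3 : ∀ n, (tp (Rm α β) n N) 0 1 * (tp (Rm α β) n N) 1 0 < 0 := by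
    intro n
    have e1 := h1 n
    have e2 := h2 n
    rw [← e1] at hτ
    nlinarith [sq_nonneg ((tp (Rm α β) n N) 0 0 - (tp (Rm α β) n N) 1 1)]
  refine ⟨h1 n, h2 n, ?_⟩
  induction n with
  | zero =>
    have : (tp (Rm α β) 0 N) 0 1 ≠ 0 := by
      intro h
      have := h3 0
      rw [h] at this
      simp at this
    exact mul_self_pos.2 this
  | succ n ih =>
    have e := (Rm_step N α β hα0 hα hβ n).2
    have h3n := h3 n
    have hr : 0 < α (n + 1) / α n := div_pos (hα0 _) (hα0 _)
    rw [e]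
    set B0 := (tp (Rm α β) 0 N) 0 1
    set B := (tp (Rm α β) n N) 0 1
    set C := (tp (Rm α β) n N) 1 0
    have hB : B ≠ 0 := by
      intro h
      rw [h] at h3n
      simp at h3n
    have h5 : 0 < B0 * -C * B ^ 2 := by
      have := mul_pos ih (neg_pos.2 h3n)
      nlinarith
    have h6 : 0 < B0 * -C := pos_of_mul_pos_left h5 (by positivity)
    rw [← mul_assoc]
    exact mul_pos h6 hr

lemma tp_deriv_entries (L : ℕ → Matrix (Fin 2) (Fin 2) ℂ) (e : ℕ → ℂ)
    (A : ℂ → ℕ → Matrix (Fin 2) (Fin 2) ℂ) (hA : ∀ x k, A x k = L k + !![0, 0; 0, x * e k])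
    (n m : ℕ) : ∃ D : Matrix (Fin 2) (Fin 2) ℂ,
      (∀ i j, HasDerivAt (fun x => tp (A x) n m i j) (D i j) 0) ∧
      ∀ M : Matrix (Fin 2) (Fin 2) ℂ, (D * M).trace =
        ∑ i ∈ Finset.range m, e (n + i) * (tp L n i * M * tp L (n + i + 1) (m - 1 - i)) 1 1 := by
  have hA0 : A 0 = L := by
    funext k
    rw [hA]
    ext i j
    fin_cases i <;> fin_cases j <;> simp
  induction m with
  | zero =>
    refine ⟨0, fun i j => ?_, fun M => by simp⟩
    simpa [tp] using hasDerivAt_const (0 : ℂ) ((1 : Matrix (Fin 2) (Fin 2) ℂ) i j)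
  | succ m ih =>
    obtain ⟨D, hD, hM⟩ := ih
    refine ⟨L (n + m) * D + !![0, 0; 0, e (n + m)] * tp L n m, fun i j => ?_, fun M => ?_⟩
    · have hAd : ∀ i j, HasDerivAt (fun x => A x (n + m) i j)
          ((!![0, 0; 0, e (n + m)] : Matrix (Fin 2) (Fin 2) ℂ) i j) 0 := by
        intro i j
        simp_rw [hA]
        have h := ((hasDerivAt_id (0 : ℂ)).mul_const (e (n + m))).const_add (L (n + m) 1 1)
        have h' := hasDerivAt_const (0 : ℂ) (L (n + m) i j)
        fin_cases i <;> fin_cases j <;> simp at h h' ⊢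
        · exact h'
        · exact h'
        · exact h'
        · exact h
      have h := ((hAd i 0).mul (hD 0 j)).add ((hAd i 1).mul (hD 1 j))
      simp only [tp, Matrix.mul_apply, Fin.sum_univ_two, Matrix.add_apply]
      rw [hA0] at h
      refine HasDerivAt.congr_deriv (f := fun x => A x (n + m) i 0 * tp (A x) n m 0 j +
        A x (n + m) i 1 * tp (A x) n m 1 j) h ?_
      ring
    · rw [add_mul, Matrix.trace_add, Finset.sum_range_succ]
      congr 1
      · rw [mul_assoc, Matrix.trace_mul_comm, mul_assoc, hM]
        refine Finset.sum_congr rfl fun i hi => ?_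
        have hi := Finset.mem_range.1 hi
        rw [show m + 1 - 1 - i = (m - 1 - i) + 1 by omega]
        simp only [tp]
        rw [show n + i + 1 + (m - 1 - i) = n + m by omega]
        simp only [mul_assoc]
      · simp [tp, Matrix.trace_fin_two, Matrix.mul_apply, Fin.sum_univ_two, Matrix.vecMul, dotProduct]

/-- complexified periodic matrix -/
noncomputable def Lc (α β : ℕ → ℝ) (n : ℕ) : Matrix (Fin 2) (Fin 2) ℂ :=
  Complex.ofRealHom.mapMatrix (Rm α β n)

lemma tp_Lc (α β : ℕ → ℝ) (n m : ℕ) (i j : Fin 2) :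
    tp (Lc α β) n m i j = ((tp (Rm α β) n m i j : ℝ) : ℂ) := by
  have := tp_map (RingHom.toMonoidHom (Complex.ofRealHom.mapMatrix : Matrix (Fin 2) (Fin 2) ℝ →+* Matrix (Fin 2) (Fin 2) ℂ)) (Rm α β) n m
  have h2 := congrFun (congrFun this i) j
  rw [show tp (Lc α β) n m i j = _ from h2.symm]
  rfl

lemma Lc_eq (α β : ℕ → ℝ) (n : ℕ) : Lc α β n =
    !![0, 1; -((α n : ℂ) / α (n + 1)), -((β (n + 1) : ℂ) / α (n + 1))] := by
  ext i j
  fin_cases i <;> fin_cases j <;> simp [Lc, Rm]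

lemma frakX_tp (N : ℕ) (hN : 1 ≤ N) (α β : ℤ → ℝ) (x : ℂ) :
    frakX α β N (N : ℤ) x = tp (fun k : ℕ => frakB α β (k + 1) x) (N - 1) N := by
  rw [← tp_list]
  unfold frakX
  have hl : ((List.range N : List ℕ) : List ℤ) = (List.range N).map (fun k : ℕ => (k : ℤ)) :=
    List.flatMap_pure_eq_map _ _
  rw [hl, List.map_map]
  congr 3
  funext k
  simp only [Function.comp]
  congr 1
  push_cast [Nat.cast_sub hN]
  ring

lemma frak_deriv_sum (N : ℕ) (hN : 1 ≤ N) (α β : ℤ → ℝ)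
    (hαper : ∀ k : ℤ, α (k + N) = α k) (hβper : ∀ k : ℤ, β (k + N) = β k)
    (t' : ℝ)
    (ht' : HasDerivAt (fun x : ℂ => Matrix.trace (frakX α β N (N : ℤ) x)) (t' : ℂ) 0) :
    t' = ∑ i ∈ Finset.range N, (tp (Rm (fun n => α n) (fun n => β n)) i N) 0 1 / α i := by
  set αN : ℕ → ℝ := fun n => α n with hαN
  set βN : ℕ → ℝ := fun n => β n with hβN
  have hα : ∀ k, αN (k + N) = αN k := fun k => by simp [hαN, hαper]
  have hβ : ∀ k, βN (k + N) = βN k := fun k => by simp [hβN, hβper]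
  have hLper : ∀ k, Lc αN βN (k + N) = Lc αN βN k := fun k => by
    unfold Lc; rw [Rm_per N αN βN hα hβ]
  obtain ⟨D, hD, hM⟩ := tp_deriv_entries (Lc αN βN) (fun k => 1 / (αN (k + 1) : ℂ))
    (fun x k => frakB α β (k + 1) x) (fun x k => by
      rw [Lc_eq]
      ext i j
      fin_cases i <;> fin_cases j <;> simp [frakB, hαN, hβN]
      ring) (N - 1) N
  have h1 : HasDerivAt (fun x : ℂ => Matrix.trace (frakX α β N (N : ℤ) x)) (D.trace) 0 := by
    rw [Matrix.trace_fin_two]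
    refine HasDerivAt.congr_of_eventuallyEq ((hD 0 0).add (hD 1 1)) ?_
    refine Filter.Eventually.of_forall fun x => ?_
    simp only [frakX_tp N hN, Matrix.trace_fin_two, Pi.add_apply]
  have h2 := ht'.unique h1
  have h3 := hM 1
  rw [mul_one] at h3
  rw [h3] at h2
  have key : ∀ i ∈ Finset.range N, 1 / (αN (N - 1 + i + 1) : ℂ) *
      (tp (Lc αN βN) (N - 1) i * (1 : Matrix (Fin 2) (Fin 2) ℂ) * tp (Lc αN βN) (N - 1 + i + 1) (N - 1 - i)) 1 1 =
      (((tp (Rm αN βN) i N) 0 1 / αN i : ℝ) : ℂ) := by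
    intro i hi
    have hi := Finset.mem_range.1 hi
    rw [mul_one]
    have e1 : tp (Lc αN βN) (N - 1) i = tp (Lc αN βN) (N - 1 + i + 1 + (N - 1 - i)) i := by
      rw [← tp_periodic _ N hLper]
      congr 1
      omega
    rw [e1, ← tp_add, show N - 1 - i + i = N - 1 by omega, show N - 1 + i + 1 = i + N by omega,
      tp_periodic _ N hLper, hα]
    have e2 : tp (Rm αN βN) i N 0 1 = tp (Rm αN βN) i (N - 1) 1 1 := by
      obtain ⟨m, rfl⟩ : ∃ m, N = m + 1 := ⟨N - 1, by omega⟩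
      simp [tp, Rm, Matrix.mul_apply, Fin.sum_univ_two]
    rw [tp_Lc, e2]
    push_cast
    ring
  rw [Finset.sum_congr rfl key, ← Complex.ofReal_sum] at h2
  exact_mod_cast h2

lemma trace_real (N : ℕ) (hN : 1 ≤ N) (α β : ℤ → ℝ) (τ : ℝ)
    (hτ : Matrix.trace (frakX α β N (N : ℤ) 0) = (τ : ℂ)) :
    (tp (Rm (fun n => α n) (fun n => β n)) (N - 1) N).trace = τ := by
  have : (fun k : ℕ => frakB α β (k + 1) 0) = Lc (fun n => α n) (fun n => β n) := by
    funext k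
    rw [Lc_eq]
    ext i j
    fin_cases i <;> fin_cases j <;> simp [frakB]
    ring
  rw [frakX_tp N hN, this, Matrix.trace_fin_two, tp_Lc, tp_Lc] at hτ
  rw [Matrix.trace_fin_two]
  exact_mod_cast hτ

lemma frak_deriv_abs (N : ℕ) (hN : 1 ≤ N) (α β : ℤ → ℝ) (hαpos : ∀ k, 0 < α k)
    (hαper : ∀ k : ℤ, α (k + N) = α k) (hβper : ∀ k : ℤ, β (k + N) = β k)
    (t' τ : ℝ) (hτ2 : τ ^ 2 < 4)
    (hτ : Matrix.trace (frakX α β N (N : ℤ) 0) = (τ : ℂ))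
    (ht' : HasDerivAt (fun x : ℂ => Matrix.trace (frakX α β N (N : ℤ) x)) (t' : ℂ) 0) :
    |t'| = ∑ i ∈ Finset.range N, |(tp (Rm (fun n => α n) (fun n => β n)) i N) 0 1| / α i := by
  have hf := Rm_facts N (fun n => α n) (fun n => β n) (fun k => hαpos _)
    (fun k => by simp [hαper]) (fun k => by simp [hβper]) τ hτ2 (N - 1) (trace_real N hN α β τ hτ)
  rw [frak_deriv_sum N hN α β hαper hβper t' ht']
  set B : ℕ → ℝ := fun i => (tp (Rm (fun n => α n) (fun n => β n)) i N) 0 1 with hB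
  have hpos : ∀ n, 0 < B 0 * B n := fun n => (hf n).2.2
  rcases lt_or_ge 0 (B 0) with h | h
  · have : ∀ n, 0 < B n := fun n => pos_of_mul_pos_right (hpos n) h.le
    rw [abs_of_nonneg (Finset.sum_nonneg fun i _ => div_nonneg (this i).le (hαpos _).le)]
    exact Finset.sum_congr rfl fun i _ => by rw [abs_of_pos (this i)]
  · have : ∀ n, B n < 0 := fun n => by
      by_contra hc
      exact absurd (hpos n) (not_lt.2 (mul_nonpos_of_nonpos_of_nonneg h (not_lt.1 hc)))
    rw [abs_of_nonpos (Finset.sum_nonpos fun i _ => div_nonpos_of_nonpos_of_nonneg (this i).le (hαpos _).le),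
      ← Finset.sum_neg_distrib]
    exact Finset.sum_congr rfl fun i _ => by rw [abs_of_neg (this i), neg_div]


section mat3
attribute [local instance] Matrix.linftyOpNormedRing Matrix.linftyOpNormedAlgebra

lemma Amat_good (N : ℕ) (hN : 1 ≤ N) (a b : ℕ → ℝ) (ha : ∀ n, 0 < a n)
    (α β : ℕ → ℝ) (hα : ∀ k, α (k + N) = α k) (hβ : ∀ k, β (k + N) = β k)
    (hmod1 : Tendsto a atTop atTop)
    (hmod2 : Tendsto (fun n : ℕ => a n / a (n + 1) - α n / α (n + 1)) atTop (𝓝 0))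
    (hmod3 : Tendsto (fun n : ℕ => b n / a n - β n / α n) atTop (𝓝 0))
    (hD1a : MemD1N N (fun n => a n / a (n + 1)))
    (hD1b : MemD1N N (fun n => b n / a n))
    (hD1c : MemD1N N (fun n => 1 / a n)) (z : ℂ) :
    GoodSeq N (Amat a b z) (Lc α β) := by
  obtain ⟨⟨C1, hC1⟩, s1⟩ := hD1a
  obtain ⟨⟨C2, hC2⟩, s2⟩ := hD1b
  obtain ⟨⟨C3, hC3⟩, s3⟩ := hD1c
  obtain ⟨C4, -, hC4⟩ := aux_periodic_bdd N hN (fun n => α n / α (n + 1))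
    (fun k => by rw [show k + N + 1 = k + 1 + N by ring, hα, hα])
  obtain ⟨C5, -, hC5⟩ := aux_periodic_bdd N hN (fun n => β (n + 1) / α (n + 1))
    (fun k => by rw [show k + N + 1 = k + 1 + N by ring, hα, hβ])
  have hinv : Tendsto (fun n => 1 / a n) atTop (𝓝 0) := by
    exact (hmod1.inv_tendsto_atTop).congr (fun n => by simp)
  have hA : ∀ n, Amat a b z n = !![0, 1; -((a n / a (n + 1) : ℝ) : ℂ),
      z * ((1 / a (n + 1) : ℝ) : ℂ) - ((b (n + 1) / a (n + 1) : ℝ) : ℂ)] := by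
    intro n
    unfold Amat
    ext i j
    fin_cases i <;> fin_cases j <;> simp
    ring
  have hL : ∀ n, Lc α β n = !![0, 1; -((α n / α (n + 1) : ℝ) : ℂ),
      -((β (n + 1) / α (n + 1) : ℝ) : ℂ)] := by
    intro n
    rw [Lc_eq]
    simp
  refine ⟨⟨1 + C1 + (‖z‖ * C3 + C2), fun n => ?_⟩, ⟨1 + C4 + C5, fun n => ?_⟩, ?_, ?_⟩
  · refine (norm_mat2_le _).trans ?_
    rw [hA]
    have h := norm_sub_le (z * ((1 / a (n + 1) : ℝ) : ℂ)) ((b (n + 1) / a (n + 1) : ℝ) : ℂ)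
    rw [norm_mul, Complex.norm_real, Complex.norm_real, Real.norm_eq_abs, Real.norm_eq_abs] at h
    have h1 := mul_le_mul_of_nonneg_left (hC3 (n + 1)) (norm_nonneg z)
    have h2 := hC2 (n + 1)
    have h3 := hC1 n
    have h4 : ‖-((a n / a (n + 1) : ℝ) : ℂ)‖ = |a n / a (n + 1)| := by
      rw [norm_neg, Complex.norm_real, Real.norm_eq_abs]
    simp only [Matrix.cons_val', Matrix.cons_val_zero, Matrix.cons_val_one, Matrix.of_apply,
      Matrix.cons_val_fin_one, norm_zero, norm_one]
    rw [h4]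
    linarith
  · refine (norm_mat2_le _).trans ?_
    rw [hL]
    have h2 := hC4 n
    have h3 := hC5 n
    simp only [Matrix.cons_val', Matrix.cons_val_zero, Matrix.cons_val_one, Matrix.of_apply,
      Matrix.cons_val_fin_one, norm_zero, norm_one, norm_neg, Complex.norm_real, Real.norm_eq_abs]
    linarith
  · have hb : Tendsto (fun n => |a n / a (n + 1) - α n / α (n + 1)| + (‖z‖ * |1 / a (n + 1)| +
        |b (n + 1) / a (n + 1) - β (n + 1) / α (n + 1)|)) atTop (𝓝 0) := by
      have e1 := hmod2.abs
      have e2 := ((hinv.comp (tendsto_add_atTop_nat 1)).abs).const_mul ‖z‖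
      have e3 := (hmod3.comp (tendsto_add_atTop_nat 1)).abs
      have := e1.add (e2.add e3)
      simpa [Function.comp] using this
    refine squeeze_zero_norm (fun n => ?_) hb
    refine (norm_mat2_le _).trans ?_
    rw [hA, hL]
    have h := norm_sub_le (z * ((1 / a (n + 1) : ℝ) : ℂ))
      ((b (n + 1) / a (n + 1) - β (n + 1) / α (n + 1) : ℝ) : ℂ)
    rw [norm_mul, Complex.norm_real, Complex.norm_real, Real.norm_eq_abs, Real.norm_eq_abs] at h
    have h4 : ‖-((a n / a (n + 1) : ℝ) : ℂ) - -((α n / α (n + 1) : ℝ) : ℂ)‖ =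
        |a n / a (n + 1) - α n / α (n + 1)| := by
      rw [← Real.norm_eq_abs, ← Complex.norm_real, ← norm_neg]
      congr 1
      push_cast
      ring
    have h5 : z * ((1 / a (n + 1) : ℝ) : ℂ) - ((b (n + 1) / a (n + 1) : ℝ) : ℂ) -
        -((β (n + 1) / α (n + 1) : ℝ) : ℂ) = z * ((1 / a (n + 1) : ℝ) : ℂ) -
        ((b (n + 1) / a (n + 1) - β (n + 1) / α (n + 1) : ℝ) : ℂ) := by
      push_cast; ring
    simp only [Matrix.cons_val', Matrix.cons_val_zero, Matrix.cons_val_one, Matrix.of_apply,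
      Matrix.cons_val_fin_one, Matrix.sub_apply, sub_self, norm_zero]
    rw [h4, h5]
    linarith
  · have s2' := (summable_nat_add_iff 1).2 s2
    have s3' := (summable_nat_add_iff 1).2 s3
    refine Summable.of_nonneg_of_le (fun _ => norm_nonneg _) (fun n => ?_)
      (s1.add ((s3'.mul_left ‖z‖).add s2'))
    refine (norm_mat2_le _).trans ?_
    rw [hA, hA]
    have h := norm_sub_le (z * ((1 / a (n + 1 + N) - 1 / a (n + 1) : ℝ) : ℂ))
      ((b (n + 1 + N) / a (n + 1 + N) - b (n + 1) / a (n + 1) : ℝ) : ℂ)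
    rw [norm_mul, Complex.norm_real, Complex.norm_real, Real.norm_eq_abs, Real.norm_eq_abs] at h
    rw [show n + N + 1 = n + 1 + N by ring]
    have h4 : ‖-((a (n + N) / a (n + 1 + N) : ℝ) : ℂ) - -((a n / a (n + 1) : ℝ) : ℂ)‖ =
        |a (n + N) / a (n + 1 + N) - a n / a (n + 1)| := by
      rw [← Real.norm_eq_abs, ← Complex.norm_real, ← norm_neg]
      congr 1
      push_cast
      ring
    have h5 : z * ((1 / a (n + 1 + N) : ℝ) : ℂ) - ((b (n + 1 + N) / a (n + 1 + N) : ℝ) : ℂ) -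
        (z * ((1 / a (n + 1) : ℝ) : ℂ) - ((b (n + 1) / a (n + 1) : ℝ) : ℂ)) =
        z * ((1 / a (n + 1 + N) - 1 / a (n + 1) : ℝ) : ℂ) -
        ((b (n + 1 + N) / a (n + 1 + N) - b (n + 1) / a (n + 1) : ℝ) : ℂ) := by
      push_cast; ring
    simp only [Matrix.cons_val', Matrix.cons_val_zero, Matrix.cons_val_one, Matrix.of_apply,
      Matrix.cons_val_fin_one, Matrix.sub_apply, sub_self, norm_zero]
    rw [h4, h5, show n + N + 1 = n + 1 + N by ring]
    linarith

end mat3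

lemma Wim_ratio (a b : ℕ → ℝ) (ha : ∀ n, 0 < a n) (N : ℕ) (hN : 1 ≤ N) (z : ℂ) (hz : 0 < z.im)
    (α β : ℕ → ℝ) (hα0 : ∀ k, 0 < α k) (hα : ∀ k, α (k + N) = α k) (hβ : ∀ k, β (k + N) = β k)
    (hmod1 : Tendsto a atTop atTop)
    (hmod2 : Tendsto (fun n : ℕ => a n / a (n + 1) - α n / α (n + 1)) atTop (𝓝 0))
    (hmod3 : Tendsto (fun n : ℕ => b n / a n - β n / α n) atTop (𝓝 0))
    (hD1a : MemD1N N (fun n => a n / a (n + 1)))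
    (hD1b : MemD1N N (fun n => b n / a n))
    (hD1c : MemD1N N (fun n => 1 / a n))
    (hCar : Tendsto (fun m => ∑ n ∈ Finset.range m, 1 / a n) atTop atTop)
    (τ : ℝ) (hτ : τ ^ 2 < 4) (m : ℕ) (hm : (tp (Rm α β) m N).trace = τ) :
    Tendsto (fun n => (Wseq a b z n).im / (√(4 - τ ^ 2) / (2 * |(tp (Rm α β) n N) 0 1|))) atTop (𝓝 1) := by
  have hgood := Amat_good N hN a b ha α β hα hβ hmod1 hmod2 hmod3 hD1a hD1b hD1c z
  have hRper := Rm_per N α β hα hβ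
  have hLper : ∀ k, Lc α β (k + N) = Lc α β k := fun k => by
    unfold Lc; rw [hRper]
  have hf := Rm_facts N α β hα0 hα hβ τ hτ m hm
  have hs : 0 < √(4 - τ ^ 2) := Real.sqrt_pos.2 (by linarith)
  obtain ⟨⟨C1, hC1⟩, -⟩ := hD1a
  have hdiv : ∀ j, Tendsto (fun m => ∑ k ∈ Finset.range m, 1 / a (k * N + j)) atTop atTop := by
    refine aux_diverge N hN (fun n => 1 / a n) (fun n => by have := ha n; positivity) C1 (fun n => ?_) hCar
    have h1 := (le_abs_self _).trans (hC1 n)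
    have a0 := ha n
    have a1 := ha (n + 1)
    calc 1 / a (n + 1) = (a n / a (n + 1)) * (1 / a n) := by field_simp
      _ ≤ _ := mul_le_mul_of_nonneg_right h1 (by positivity)
  refine aux_classes N hN _ _ fun j => ?_
  have hB0 : (tp (Rm α β) j N) 0 1 ≠ 0 := by
    intro h
    have := (hf j).2.2
    rw [h] at this
    simp at this
  have h := Wseq_class a b ha N hN z hz (Lc α β) hLper hgood j (hdiv j) _ _ _ _ τ
    (tp_Lc α β j N 0 0) (tp_Lc α β j N 0 1) (tp_Lc α β j N 1 0) (tp_Lc α β j N 1 1)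
    (hf j).2.1 (hf j).1 hτ hB0
  have hv : √(4 - τ ^ 2) / (2 * |(tp (Rm α β) j N) 0 1|) ≠ 0 := by
    have := abs_pos.2 hB0
    positivity
  have h2 := h.div_const (√(4 - τ ^ 2) / (2 * |(tp (Rm α β) j N) 0 1|))
  rw [div_self hv] at h2
  refine h2.congr fun k => ?_
  rw [tp_periodic' _ N hRper]

lemma aux_phi (x : ℕ → ℝ) (hx0 : ∀ k, x k ≠ 0) (hx : Tendsto x atTop (𝓝 0)) :
    Tendsto (fun k => -Real.log (1 - x k) / x k) atTop (𝓝 1) := by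
  have hd : HasDerivAt (fun y : ℝ => -Real.log (1 - y)) 1 0 := by
    have h1 : HasDerivAt (fun y : ℝ => 1 - y) (-1) 0 := by
      simpa using (hasDerivAt_id (0 : ℝ)).const_sub 1
    have h2 := (h1.log (by norm_num)).neg
    exact HasDerivAt.congr_deriv (f := fun y : ℝ => -Real.log (1 - y)) h2 (by norm_num)
  rw [hasDerivAt_iff_tendsto_slope] at hd
  have h3 : Tendsto x atTop (𝓝[≠] 0) :=
    tendsto_nhdsWithin_iff.2 ⟨hx, Eventually.of_forall fun k => hx0 k⟩
  refine (hd.comp h3).congr fun k => ?_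
  simp [slope_def_field]

lemma Wsum_lim (a b : ℕ → ℝ) (ha : ∀ n, 0 < a n) (N : ℕ) (hN : 1 ≤ N) (z : ℂ) (hz : 0 < z.im)
    (α v : ℕ → ℝ) (hα0 : ∀ k, 0 < α k) (hα : ∀ k, α (k + N) = α k)
    (hv0 : ∀ k, 0 < v k) (hv : ∀ k, v (k + N) = v k)
    (hmod1 : Tendsto a atTop atTop)
    (hmod2 : Tendsto (fun n : ℕ => a n / a (n + 1) - α n / α (n + 1)) atTop (𝓝 0))
    (hsum : Tendsto (fun m => ∑ n ∈ Finset.range m, α n / a n) atTop atTop)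
    (hr : Tendsto (fun n => (Wseq a b z n).im / v n) atTop (𝓝 1)) :
    Tendsto (fun n => (∑ k ∈ Finset.range (n + 1), α k / a k)⁻¹ *
      (∑ k ∈ Finset.range (n + 1), Real.log (‖Wseq a b z k‖ ^ 2) + Real.log (a (n + 1)))) atTop
      (𝓝 (z.im * ((∑ j ∈ Finset.range N, 1 / (α j * v j)) / N))) := by
  have hW := Wseq_im_pos a b ha z hz
  have hWn : ∀ k, 0 < ‖Wseq a b z k‖ := fun k => norm_pos_iff.2 (ne_zero_of_im_pos (hW k))
  set t := z.im with ht
  set ω : ℕ → ℝ := fun k => α k / a k with hωdef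
  have hω : ∀ k, 0 < ω k := fun k => div_pos (hα0 k) (ha k)
  obtain ⟨Cα, hCα0, hCα⟩ := aux_periodic_bdd N hN α hα
  obtain ⟨Cl, hCl0, hCl⟩ := aux_periodic_bdd N hN (fun k => Real.log (v k)) (fun k => by rw [hv])
  obtain ⟨Cπ, hCπ0, hCπ⟩ := aux_periodic_bdd N hN (fun k => 1 / (α k * v k)) (fun k => by rw [hv, hα])
  obtain ⟨Cq, hCq0, hCq⟩ := aux_periodic_bdd N hN (fun k => α (k + 1) / α k) (fun k => by
    rw [show k + N + 1 = k + 1 + N by ring, hα, hα])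
  have hinv : Tendsto (fun n => (a n)⁻¹) atTop (𝓝 0) := hmod1.inv_tendsto_atTop
  have hω0 : Tendsto ω atTop (𝓝 0) := by
    refine squeeze_zero (fun k => (hω k).le) (fun k => ?_)
      (by simpa using hinv.const_mul Cα : Tendsto (fun n => Cα * (a n)⁻¹) atTop (𝓝 0))
    have := ha k
    exact mul_le_mul_of_nonneg_right ((le_abs_self _).trans (hCα k)) (by positivity)
  obtain ⟨Cω, hCω⟩ := hω0.bddAbove_range
  have hωb : ∃ C, ∀ k, ω k ≤ C := ⟨Cω, fun k => hCω ⟨k, rfl⟩⟩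
  have hωr : Tendsto (fun k => ω (k + 1) / ω k) atTop (𝓝 1) := by
    have h1 : Tendsto (fun k => (a k / a (k + 1) - α k / α (k + 1)) * (α (k + 1) / α k)) atTop (𝓝 0) := by
      refine squeeze_zero_norm (fun k => ?_)
        (by simpa using hmod2.norm.mul_const Cq :
          Tendsto (fun k => ‖a k / a (k + 1) - α k / α (k + 1)‖ * Cq) atTop (𝓝 0))
      rw [norm_mul]
      exact mul_le_mul_of_nonneg_left (hCq k) (norm_nonneg _)
    have h2 := h1.add_const 1
    rw [zero_add] at h2
    refine h2.congr fun k => ?_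
    have := (ha k).ne'
    have := (ha (k + 1)).ne'
    have := (hα0 k).ne'
    have := (hα0 (k + 1)).ne'
    simp only [hωdef]
    field_simp
    ring
  -- the quantities g, x, e
  set g : ℕ → ℝ := fun k => a k * (Wseq a b z k).im with hg
  have hg0 : ∀ k, 0 < g k := fun k => mul_pos (ha k) (hW k)
  set x : ℕ → ℝ := fun k => t / g k with hx
  set e : ℕ → ℝ := fun k => -Real.log (1 - x k) with he
  set r : ℕ → ℝ := fun k => (Wseq a b z k).im / v k with hrdef
  have hr0 : ∀ k, 0 < r k := fun k => div_pos (hW k) (hv0 k)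
  have hri : Tendsto (fun k => (r k)⁻¹) atTop (𝓝 1) := by simpa using hr.inv₀ one_ne_zero
  have hxr : ∀ k, x k = ω k * (t * (1 / (α k * v k)) * (r k)⁻¹) := by
    intro k
    have := (ha k).ne'
    have := (hα0 k).ne'
    have := (hv0 k).ne'
    have := (hW k).ne'
    simp only [hx, hg, hωdef, hrdef]
    field_simp
  have hx0 : ∀ k, x k ≠ 0 := fun k => (div_pos hz (hg0 k)).ne'
  have hxt : Tendsto x atTop (𝓝 0) := by
    have h1 : Tendsto (fun k => ω k * (t * Cπ * (r k)⁻¹)) atTop (𝓝 0) := by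
      simpa using hω0.mul (hri.const_mul (t * Cπ))
    refine squeeze_zero (fun k => (div_pos hz (hg0 k)).le) (fun k => ?_) h1
    rw [hxr]
    have h2 := hr0 k
    have h3 := (le_abs_self _).trans (hCπ k)
    have h4 := (hω k).le
    gcongr
  have hphi := aux_phi x hx0 hxt
  have heω : Tendsto (fun k => e k / ω k - t * (1 / (α k * v k))) atTop (𝓝 0) := by
    have h1 : Tendsto (fun k => -Real.log (1 - x k) / x k * (r k)⁻¹ - 1) atTop (𝓝 0) := by
      simpa using (hphi.mul hri).sub_const 1
    refine squeeze_zero_norm (fun k => ?_)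
      (by simpa using h1.norm.const_mul (t * Cπ) :
        Tendsto (fun k => t * Cπ * ‖-Real.log (1 - x k) / x k * (r k)⁻¹ - 1‖) atTop (𝓝 0))
    have e1 : e k / ω k - t * (1 / (α k * v k)) =
        t * (1 / (α k * v k)) * (-Real.log (1 - x k) / x k * (r k)⁻¹ - 1) := by
      have h5 := hxr k
      have h6 := hx0 k
      have := (hω k).ne'
      have := (hα0 k).ne'
      have := (hv0 k).ne'
      have := (hr0 k).ne'
      have h7 : 1 / ω k = t * (1 / (α k * v k)) * (r k)⁻¹ / x k := by
        rw [h5] at h6 ⊢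
        have hz' := hz.ne'
        field_simp
      simp only [he]
      rw [div_eq_mul_one_div _ (ω k), h7]
      ring
    rw [e1, norm_mul]
    refine mul_le_mul_of_nonneg_right ?_ (norm_nonneg _)
    rw [norm_mul, Real.norm_of_nonneg hz.le]
    exact mul_le_mul_of_nonneg_left (hCπ k) hz.le
  have hces := aux_cesaro N hN ω e (fun k => 1 / (α k * v k)) t hω hsum hωb hωr
    (fun k => by rw [hv, hα]) heω
  have he0 : Tendsto e atTop (𝓝 0) := by
    have h1 := hphi.mul hxt
    rw [mul_zero] at h1
    refine h1.congr fun k => ?_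
    rw [div_mul_cancel₀ _ (hx0 k)]
  have hrec : ∀ k, g (k + 1) = t + g k / ‖Wseq a b z k‖ ^ 2 := by
    intro k
    simp only [hg, Wseq, mstep_im]
    have := (ha (k + 1)).ne'
    field_simp
    rw [mul_div_assoc, ← ht]
  have hlog : ∀ k, Real.log (‖Wseq a b z k‖ ^ 2) = Real.log (g k) - Real.log (g (k + 1)) + e (k + 1) := by
    intro k
    have h1 := hrec k
    have h2 := hWn k
    have h3 := hg0 k
    have h4 := hg0 (k + 1)
    have h5 : 1 - x (k + 1) = (g k / ‖Wseq a b z k‖ ^ 2) / g (k + 1) := by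
      simp only [hx]
      rw [eq_div_iff h4.ne', sub_mul, div_mul_cancel₀ _ h4.ne', h1]
      ring
    simp only [he]
    rw [h5, Real.log_div (by positivity) h4.ne', Real.log_div h3.ne' (by positivity)]
    ring
  have hS : ∀ n, ∑ k ∈ Finset.range (n + 1), Real.log (‖Wseq a b z k‖ ^ 2) + Real.log (a (n + 1)) =
      (Real.log (g 0) - e 0) - Real.log (r (n + 1)) - Real.log (v (n + 1)) + e (n + 1) +
        ∑ k ∈ Finset.range (n + 1), e k := by
    intro n
    have h1 : ∑ k ∈ Finset.range (n + 1), Real.log (‖Wseq a b z k‖ ^ 2) =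
        Real.log (g 0) - Real.log (g (n + 1)) + ∑ k ∈ Finset.range (n + 1), e (k + 1) := by
      rw [Finset.sum_congr rfl fun k _ => hlog k, Finset.sum_add_distrib, Finset.sum_range_sub']
    have h2 := Finset.sum_range_succ' e (n + 1)
    rw [Finset.sum_range_succ] at h2
    have h3 : Real.log (g (n + 1)) = Real.log (a (n + 1)) + Real.log (r (n + 1)) + Real.log (v (n + 1)) := by
      have : g (n + 1) = a (n + 1) * r (n + 1) * v (n + 1) := by
        simp only [hg, hrdef]
        have := (hv0 (n + 1)).ne'
        field_simp
      rw [this, Real.log_mul (mul_pos (ha _) (hr0 _)).ne' (hv0 _).ne', Real.log_mul (ha _).ne' (hr0 _).ne']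
    rw [h1, h3]
    linarith
  have hΩ : Tendsto (fun n => (∑ k ∈ Finset.range (n + 1), ω k)⁻¹) atTop (𝓝 0) :=
    (hsum.comp (tendsto_add_atTop_nat 1)).inv_tendsto_atTop
  have p1 := hΩ.mul_const (Real.log (g 0) - e 0)
  have p2 : Tendsto (fun n => Real.log (r (n + 1))) atTop (𝓝 0) := by
    have h1 := (Real.continuousAt_log one_ne_zero).tendsto.comp (hr.comp (tendsto_add_atTop_nat 1))
    rw [Real.log_one] at h1
    exact h1
  have p3 := hΩ.mul p2
  have p4 : Tendsto (fun n => (∑ k ∈ Finset.range (n + 1), ω k)⁻¹ * Real.log (v (n + 1))) atTop (𝓝 0) := by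
    refine squeeze_zero_norm (fun n => ?_)
      (by simpa using hΩ.norm.mul_const Cl :
        Tendsto (fun n => ‖(∑ k ∈ Finset.range (n + 1), ω k)⁻¹‖ * Cl) atTop (𝓝 0))
    rw [norm_mul]
    exact mul_le_mul_of_nonneg_left (hCl _) (norm_nonneg _)
  have p5 := hΩ.mul (he0.comp (tendsto_add_atTop_nat 1))
  have p6 := hces.comp (tendsto_add_atTop_nat 1)
  have p := (((p1.sub p3).sub p4).add p5).add p6
  simp only [zero_mul, mul_zero, sub_zero, zero_add] at p
  refine p.congr fun n => ?_
  rw [hS]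
  simp only [Function.comp]
  rw [div_eq_inv_mul]
  ring

/-- the orthonormal polynomials as polynomials -/
noncomputable def Qpol (a b : ℕ → ℝ) : ℕ → Polynomial ℝ
  | 0 => 1
  | 1 => Polynomial.C (1 / a 0) * (Polynomial.X - Polynomial.C (b 0))
  | n + 2 => Polynomial.C (1 / a (n + 1)) *
      ((Polynomial.X - Polynomial.C (b (n + 1))) * Qpol a b (n + 1) - Polynomial.C (a n) * Qpol a b n)

lemma Qpol_eval (a b : ℕ → ℝ) (ha : ∀ n, 0 < a n) (p : ℕ → ℝ → ℝ)
    (hp0 : ∀ x : ℝ, p 0 x = 1)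
    (hp1 : ∀ x : ℝ, p 1 x = (x - b 0) / a 0)
    (hprec : ∀ n : ℕ, ∀ x : ℝ,
      a n * p n x + b (n + 1) * p (n + 1) x + a (n + 1) * p (n + 2) x = x * p (n + 1) x)
    (x : ℝ) (n : ℕ) : (Qpol a b n).eval x = p n x ∧ (Qpol a b (n + 1)).eval x = p (n + 1) x := by
  induction n with
  | zero =>
    refine ⟨by simp [Qpol, hp0], ?_⟩
    simp [Qpol, hp1]
    ring
  | succ n ih =>
    refine ⟨ih.2, ?_⟩
    simp only [Qpol, Polynomial.eval_mul, Polynomial.eval_sub, Polynomial.eval_X, Polynomial.eval_C,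
      ih.1, ih.2]
    have h := hprec n x
    have := (ha (n + 1)).ne'
    field_simp
    linarith

lemma Qpol_natDegree (a b : ℕ → ℝ) (n : ℕ) :
    (Qpol a b n).natDegree ≤ n ∧ (Qpol a b (n + 1)).natDegree ≤ n + 1 := by
  induction n with
  | zero =>
    refine ⟨by simp [Qpol], ?_⟩
    simp only [Qpol]
    exact (Polynomial.natDegree_C_mul_le _ _).trans (by simp)
  | succ n ih =>
    refine ⟨ih.2, ?_⟩
    simp only [Qpol]
    refine (Polynomial.natDegree_C_mul_le _ _).trans ((Polynomial.natDegree_sub_le _ _).trans ?_)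
    refine max_le (Polynomial.natDegree_mul_le.trans ?_) ((Polynomial.natDegree_C_mul_le _ _).trans (by omega))
    rw [Polynomial.natDegree_X_sub_C]
    omega

lemma Qpol_aeval (a b : ℕ → ℝ) (ha : ∀ n, 0 < a n) (z : ℂ) (hz : 0 < z.im) (n : ℕ) :
    Polynomial.aeval z (Qpol a b n) = ∏ k ∈ Finset.range n, Wseq a b z k ∧
    Polynomial.aeval z (Qpol a b (n + 1)) = ∏ k ∈ Finset.range (n + 1), Wseq a b z k := by
  induction n with
  | zero =>
    refine ⟨by simp [Qpol], ?_⟩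
    simp [Qpol, Wseq]
    ring
  | succ n ih =>
    refine ⟨ih.2, ?_⟩
    have hW := ne_zero_of_im_pos (Wseq_im_pos a b ha z hz n)
    have ha1 : (a (n + 1) : ℂ) ≠ 0 := by exact_mod_cast (ha _).ne'
    simp only [Qpol, map_mul, map_sub, Polynomial.aeval_X, Polynomial.aeval_C, ih.1, ih.2]
    rw [Finset.prod_range_succ _ (n + 1), Finset.prod_range_succ _ n]
    simp only [Wseq, mstep, Complex.coe_algebraMap]
    push_cast
    field_simp

lemma log_sum_eq (a b : ℕ → ℝ) (ha : ∀ n, 0 < a n) (p : ℕ → ℝ → ℝ)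
    (hp0 : ∀ x : ℝ, p 0 x = 1)
    (hp1 : ∀ x : ℝ, p 1 x = (x - b 0) / a 0)
    (hprec : ∀ n : ℕ, ∀ x : ℝ,
      a n * p n x + b (n + 1) * p (n + 1) x + a (n + 1) * p (n + 2) x = x * p (n + 1) x)
    (Z : ℕ → Finset ℝ)
    (hZcard : ∀ n, (Z n).card = n + 1)
    (hZ : ∀ n, ∀ y : ℝ, y ∈ Z n ↔ p (n + 1) y = 0) (n : ℕ) : ∃ c : ℝ, ∀ s t : ℝ, 0 < t →
    ∑ y ∈ Z n, Real.log ((s - y) ^ 2 + t ^ 2) =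
      ∑ k ∈ Finset.range (n + 1), Real.log (‖Wseq a b ⟨s, t⟩ k‖ ^ 2) - c := by
  set Q := Qpol a b (n + 1) with hQ
  have hQ0 : Q ≠ 0 := by
    intro h
    have := (Qpol_aeval a b ha Complex.I (by simp) n).2
    rw [← hQ, h, map_zero] at this
    exact (Finset.prod_ne_zero_iff.2 fun k _ =>
      ne_zero_of_im_pos (Wseq_im_pos a b ha Complex.I (by simp) k)) this.symm
  have hsub : (Z n).val ≤ Q.roots := by
    refine (Multiset.le_iff_subset (Z n).nodup).2 fun y hy => ?_
    rw [Polynomial.mem_roots hQ0, Polynomial.IsRoot, (Qpol_eval a b ha p hp0 hp1 hprec y n).2]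
    exact (hZ n y).1 hy
  have hdeg : Q.natDegree ≤ n + 1 := (Qpol_natDegree a b n).2
  have hroots : Q.roots = (Z n).val := by
    refine (Multiset.eq_of_le_of_card_le hsub ?_).symm
    refine (Polynomial.card_roots' Q).trans ?_
    rw [Finset.card_val, hZcard]
    exact hdeg
  have hcard : Multiset.card Q.roots = Q.natDegree := by
    refine le_antisymm (Polynomial.card_roots' Q) ?_
    rw [hroots, Finset.card_val, hZcard]
    exact hdeg
  have hprod := Polynomial.C_leadingCoeff_mul_prod_multiset_X_sub_C hcard
  rw [hroots] at hprod
  have hlc : Q.leadingCoeff ≠ 0 := Polynomial.leadingCoeff_ne_zero.2 hQ0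
  refine ⟨Real.log (Q.leadingCoeff ^ 2), fun s t ht => ?_⟩
  set z : ℂ := ⟨s, t⟩ with hz
  have hzim : 0 < z.im := ht
  have e1 := (Qpol_aeval a b ha z hzim n).2
  rw [← hQ, ← hprod] at e1
  have e2 : Polynomial.aeval z (Polynomial.C Q.leadingCoeff *
      ((Z n).val.map fun y => Polynomial.X - Polynomial.C y).prod) =
      (Q.leadingCoeff : ℂ) * ∏ y ∈ Z n, (z - (y : ℂ)) := by
    rw [map_mul, Polynomial.aeval_C]
    change _ * Polynomial.aeval z (∏ y ∈ Z n, (Polynomial.X - Polynomial.C y)) = _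
    rw [map_prod]
    simp
  rw [e2] at e1
  have e3 := congrArg (fun w : ℂ => Real.log (‖w‖ ^ 2)) e1
  have hy : ∀ y : ℝ, ‖z - (y : ℂ)‖ ^ 2 = (s - y) ^ 2 + t ^ 2 := by
    intro y
    rw [Complex.sq_norm, Complex.normSq_apply]
    simp [hz]
    ring
  simp only [norm_mul, norm_prod, mul_pow, ← Finset.prod_pow, hy] at e3
  rw [Real.log_mul, Real.log_prod, Real.log_prod] at e3
  · rw [← e3, Complex.norm_real, Real.norm_eq_abs, sq_abs]
    ring
  · intro k _
    have := norm_pos_iff.2 (ne_zero_of_im_pos (Wseq_im_pos a b ha z hzim k))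
    positivity
  · intro y _
    positivity
  · have := norm_pos_iff.2 (Complex.ofReal_ne_zero.2 hlc)
    positivity
  · exact Finset.prod_ne_zero_iff.2 fun y _ => by positivity

/-- Theorem A = Theorem A:1 of the paper. -/
theorem stmt_17
    (N : ℕ) (hN : 1 ≤ N)
    (a b : ℕ → ℝ) (ha : ∀ n, 0 < a n)
    (α β : ℤ → ℝ) (hαpos : ∀ k, 0 < α k)
    (hαper : ∀ k : ℤ, α (k + N) = α k) (hβper : ∀ k : ℤ, β (k + N) = β k)
    (hmod1 : Tendsto a atTop atTop)
    (hmod2 : Tendsto (fun n : ℕ => a n / a (n + 1) - α n / α (n + 1)) atTop (𝓝 0))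
    (hmod3 : Tendsto (fun n : ℕ => b n / a n - β n / α n) atTop (𝓝 0))
    (p : ℕ → ℝ → ℝ)
    (hp0 : ∀ x : ℝ, p 0 x = 1)
    (hp1 : ∀ x : ℝ, p 1 x = (x - b 0) / a 0)
    (hprec : ∀ n : ℕ, ∀ x : ℝ,
      a n * p n x + b (n + 1) * p (n + 1) x + a (n + 1) * p (n + 2) x = x * p (n + 1) x)
    (Z : ℕ → Finset ℝ)
    (hZcard : ∀ n, (Z n).card = n + 1)
    (hZ : ∀ n, ∀ y : ℝ, y ∈ Z n ↔ p (n + 1) y = 0)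
    (τ : ℝ) (hτ : Matrix.trace (frakX α β N (N : ℤ) 0) = (τ : ℂ))
    (hτmem : τ ∈ Set.Ioo (-2 : ℝ) 2)
    (t' : ℝ)
    (ht' : HasDerivAt (fun x : ℂ => Matrix.trace (frakX α β N (N : ℤ) x)) (t' : ℂ) 0)
    (hD1a : MemD1N N (fun n => a n / a (n + 1)))
    (hD1b : MemD1N N (fun n => b n / a n))
    (hD1c : MemD1N N (fun n => 1 / a n))
    (hCar : Tendsto (fun m => ∑ n ∈ Finset.range m, 1 / a n) atTop atTop)
    (ρ : ℕ → ℝ) (hρ : ∀ n, ρ n = ∑ k ∈ Finset.range (n + 1), α k / a k) :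
    ∀ f : ℝ → ℝ, Continuous f → (∃ C : ℝ, ∀ x : ℝ, (1 + x ^ 2) * |f x| ≤ C) →
      Tendsto (fun n => (ρ n)⁻¹ * ∑ y ∈ Z n, f y) atTop
        (𝓝 ((|t'| / (Real.pi * N * Real.sqrt (4 - τ ^ 2))) * ∫ x : ℝ, f x)) := by
  intro f hf hfC
  obtain ⟨C, hC⟩ := hfC
  have hτ2 : τ ^ 2 < 4 := by nlinarith [hτmem.1, hτmem.2]
  have hs : 0 < √(4 - τ ^ 2) := Real.sqrt_pos.2 (by linarith)
  have hN0 : (N : ℝ) ≠ 0 := by positivity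
  set αN : ℕ → ℝ := fun n => α n with hαN
  set βN : ℕ → ℝ := fun n => β n with hβN
  have hα0 : ∀ k, 0 < αN k := fun k => hαpos _
  have hα : ∀ k, αN (k + N) = αN k := fun k => by simp [hαN, hαper]
  have hβ : ∀ k, βN (k + N) = βN k := fun k => by simp [hβN, hβper]
  have htr := trace_real N hN α β τ hτ
  have hfacts := Rm_facts N αN βN hα0 hα hβ τ hτ2 (N - 1) htr
  have hB0 : ∀ n, 0 < |(tp (Rm αN βN) n N) 0 1| := by
    intro n
    refine abs_pos.2 fun h => ?_
    have := (hfacts n).2.2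
    rw [h] at this
    simp at this
  have habs := frak_deriv_abs N hN α β hαpos hαper hβper t' τ hτ2 hτ ht'
  set v : ℕ → ℝ := fun n => √(4 - τ ^ 2) / (2 * |(tp (Rm αN βN) n N) 0 1|) with hv
  have hv0 : ∀ k, 0 < v k := fun k => by
    have := hB0 k
    simp only [hv]
    positivity
  have hvper : ∀ k, v (k + N) = v k := fun k => by
    simp only [hv]
    rw [tp_periodic _ N (Rm_per N αN βN hα hβ)]
  have hmod2' : Tendsto (fun n : ℕ => a n / a (n + 1) - αN n / αN (n + 1)) atTop (𝓝 0) := by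
    simpa [hαN] using hmod2
  have hsum : Tendsto (fun m => ∑ n ∈ Finset.range m, αN n / a n) atTop atTop := by
    obtain ⟨K, hK0, hK⟩ := aux_periodic_bdd N hN (fun k => 1 / αN k) (fun k => by rw [hα])
    have hK1 : 0 < K := lt_of_lt_of_le (by have := hα0 0; positivity) ((le_abs_self _).trans (hK 0))
    refine tendsto_atTop_mono (fun m => ?_) (hCar.const_mul_atTop (inv_pos.2 hK1))
    rw [Finset.mul_sum]
    refine Finset.sum_le_sum fun n _ => ?_
    have h1 := (le_abs_self _).trans (hK n)
    have h2 : K⁻¹ ≤ αN n := by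
      rw [inv_le_comm₀ hK1 (hα0 n), ← one_div]
      exact h1
    have h3 : 0 ≤ 1 / a n := by have := ha n; positivity
    calc K⁻¹ * (1 / a n) ≤ αN n * (1 / a n) := mul_le_mul_of_nonneg_right h2 h3
      _ = _ := by ring
  have hρpos : ∀ n, 0 < ρ n := fun n => by
    rw [hρ]
    exact Finset.sum_pos (fun k _ => div_pos (hαpos _) (ha k)) ⟨0, by simp⟩
  set κ : ℝ := |t'| / (N * √(4 - τ ^ 2)) with hκ
  have hκ0 : 0 ≤ κ := by positivity
  have hmean : (∑ j ∈ Finset.range N, 1 / (αN j * v j)) / N = 2 * κ := by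
    rw [hκ, habs, Finset.sum_div, Finset.sum_div, Finset.mul_sum]
    refine Finset.sum_congr rfl fun j _ => ?_
    have h1 := hB0 j
    have h2 := (hα0 j).ne'
    simp only [hv]
    change 1 / (αN j * _) / _ = 2 * (_ / αN j / _)
    field_simp
    rfl
  have hW : ∀ s t : ℝ, 0 < t → Tendsto (fun n => (ρ n)⁻¹ *
      (∑ k ∈ Finset.range (n + 1), Real.log (‖Wseq a b ⟨s, t⟩ k‖ ^ 2) + Real.log (a (n + 1)))) atTop
      (𝓝 (t * (2 * κ))) := by
    intro s t ht
    have hr := Wim_ratio a b ha N hN ⟨s, t⟩ ht αN βN hα0 hα hβ hmod1 hmod2' hmod3 hD1a hD1b hD1c hCar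
      τ hτ2 (N - 1) htr
    have h := Wsum_lim a b ha N hN ⟨s, t⟩ ht αN v hα0 hα hv0 hvper hmod1 hmod2' hsum hr
    rw [hmean] at h
    refine h.congr fun n => ?_
    rw [hρ]
  have hlogs : ∀ s t t₁ : ℝ, 0 < t → t < t₁ → Tendsto (fun n => (ρ n)⁻¹ * ∑ y ∈ Z n,
      (Real.log ((s - y) ^ 2 + t₁ ^ 2) - Real.log ((s - y) ^ 2 + t ^ 2))) atTop
      (𝓝 (2 * κ * (t₁ - t))) := by
    intro s t t₁ ht htt
    have h := (hW s t₁ (ht.trans htt)).sub (hW s t ht)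
    rw [show t₁ * (2 * κ) - t * (2 * κ) = 2 * κ * (t₁ - t) by ring] at h
    refine h.congr fun n => ?_
    obtain ⟨c, hc⟩ := log_sum_eq a b ha p hp0 hp1 hprec Z hZcard hZ n
    rw [Finset.sum_sub_distrib, hc s t₁ (ht.trans htt), hc s t ht]
    ring
  have hP : ∀ s t : ℝ, 0 < t → Tendsto (fun n => (ρ n)⁻¹ * ∑ y ∈ Z n,
      t ^ 2 / ((s - y) ^ 2 + t ^ 2)) atTop (𝓝 (κ * t)) := fun s t ht =>
    aux_poisson_of_log Z ρ hρpos κ hκ0 s (fun t t₁ h h' => hlogs s t t₁ h h') t ht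
  have hfin := aux_full Z ρ hρpos κ hκ0 hP f hf C hC
  rw [show |t'| / (Real.pi * N * √(4 - τ ^ 2)) = κ / Real.pi by
    rw [hκ, div_div]; congr 1; ring]
  exact hfin
end

section
/- Let (a_n), (b_n) be N-periodically modulated Jacobi parameters such that tr 𝔛_N(0) ∈ ℝ∖[−2, 2] and the sequences (a_{n−1}/a_n)_{n≥1}, (b_n/a_n)_{n≥0} and (1/a_n)_{n≥0} belong to D_1^N. Then for every sequence (ρ_n) of positive reals tending to infinity and every continuous f : ℝ → ℝ with compact support, (1/ρ_n) ∫ f dν_n → 0 as n → ∞; that is, (1/ρ_n)·ν_n converges vaguely to the zero measure. -/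
open Filter Topology

open scoped Matrix.Norms.Operator

/-- One-step transfer matrix at `0`, real version. -/
noncomputable def realB (α β : ℤ → ℝ) (j : ℤ) : Matrix (Fin 2) (Fin 2) ℝ :=
  !![0, 1; -(α (j - 1) / α j), -(β j / α j)]

/-- Products of the one-step transfer matrices. -/
noncomputable def realP (α β : ℤ → ℝ) (n : ℤ) : ℕ → Matrix (Fin 2) (Fin 2) ℝ
  | 0 => 1
  | j + 1 => realB α β (n + j) * realP α β n j

lemma frakX_eq_map (α β : ℤ → ℝ) (n : ℤ) (j : ℕ) :
    frakX α β j n 0 = (realP α β n j).map Complex.ofReal := by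
  induction j with
  | zero =>
    simp [frakX, realP]
  | succ j ih =>
    have h : frakX α β (j + 1) n 0 = frakB α β (n + j) 0 * frakX α β j n 0 := by
      simp [frakX, List.range_succ]
    have h2 : frakB α β (n + j) 0 = (realB α β (n + j)).map Complex.ofReal := by
      ext i k
      fin_cases i <;> fin_cases k <;> simp [frakB, realB, neg_div]
    rw [h, ih, h2, realP]
    exact (Matrix.map_mul (f := Complex.ofRealHom)).symm

lemma realP_succ_left (α β : ℤ → ℝ) (n : ℤ) (j : ℕ) :
    realP α β n (j + 1) = realP α β (n + 1) j * realB α β n := by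
  induction j with
  | zero => simp [realP]
  | succ j ih =>
    rw [realP, ih, realP, mul_assoc]
    congr 2
    push_cast; ring

lemma realP_det (α β : ℤ → ℝ) (hα : ∀ k, 0 < α k) (n : ℤ) (j : ℕ) :
    (realP α β n j).det = α (n - 1) / α (n + j - 1) := by
  induction j with
  | zero => simp [realP, (hα (n - 1)).ne']
  | succ j ih =>
    have e : n + ((j + 1 : ℕ) : ℤ) - 1 = n + j := by push_cast; ring
    rw [realP, Matrix.det_mul, ih, e]
    simp only [realB, Matrix.det_fin_two_of]
    have h1 := (hα (n + j - 1)).ne'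
    have h2 := (hα (n + j)).ne'
    field_simp
    ring

lemma realB_per (α β : ℤ → ℝ) (N : ℕ) (hα : ∀ k : ℤ, α (k + N) = α k)
    (hβ : ∀ k : ℤ, β (k + N) = β k) (k : ℤ) : realB α β (k + N) = realB α β k := by
  have e : k + (N : ℤ) - 1 = (k - 1) + N := by ring
  simp only [realB, e, hα, hβ]

lemma realP_per (α β : ℤ → ℝ) (N : ℕ) (hα : ∀ k : ℤ, α (k + N) = α k)
    (hβ : ∀ k : ℤ, β (k + N) = β k) (k : ℤ) (j : ℕ) :
    realP α β (k + N) j = realP α β k j := by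
  induction j with
  | zero => simp [realP]
  | succ j ih =>
    have e : k + (N : ℤ) + j = (k + j) + N := by ring
    rw [realP, ih, realP, e, realB_per α β N hα hβ]

lemma realP_trace_succ (α β : ℤ → ℝ) (N : ℕ) (hN : 1 ≤ N) (hα : ∀ k : ℤ, α (k + N) = α k)
    (hβ : ∀ k : ℤ, β (k + N) = β k) (k : ℤ) :
    (realP α β (k + 1) N).trace = (realP α β k N).trace := by
  obtain ⟨m, rfl⟩ : ∃ m, N = m + 1 := ⟨N - 1, by omega⟩
  rw [realP_succ_left α β k m, realP, Matrix.trace_mul_comm]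
  have e : k + 1 + (m : ℤ) = k + ((m + 1 : ℕ) : ℤ) := by push_cast; ring
  rw [e, realB_per α β (m + 1) hα hβ]

lemma realP_trace (α β : ℤ → ℝ) (N : ℕ) (hN : 1 ≤ N) (hα : ∀ k : ℤ, α (k + N) = α k)
    (hβ : ∀ k : ℤ, β (k + N) = β k) (k : ℕ) :
    (realP α β k N).trace = (realP α β 0 N).trace := by
  induction k with
  | zero => simp
  | succ k ih =>
    rw [← ih, ← realP_trace_succ α β N hN hα hβ (k : ℤ)]
    push_cast; rfl

lemma periodic_bdd {E : Type*} [SeminormedAddCommGroup E] (N : ℕ) (hN : 1 ≤ N) (f : ℤ → E)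
    (hf : ∀ k, f (k + N) = f k) : ∃ C : ℝ, 0 ≤ C ∧ ∀ k, ‖f k‖ ≤ C := by
  have hper : Function.Periodic f (N : ℤ) := hf
  refine ⟨∑ i ∈ Finset.Ico (0 : ℤ) N, ‖f i‖, Finset.sum_nonneg fun _ _ => norm_nonneg _, ?_⟩
  intro k
  have h1 : f (k % N) = f k := by
    have h2 := Int.emod_add_mul_ediv k N
    have h3 := hper.int_mul (k / N) (k % N)
    rw [← h3]
    congr 1
    simp only [Int.cast_id]
    linarith [mul_comm (k / (N : ℤ)) (N : ℤ)]
  rw [← h1]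
  apply Finset.single_le_sum (f := fun i => ‖f i‖) (fun _ _ => norm_nonneg _)
  rw [Finset.mem_Ico]
  exact ⟨Int.emod_nonneg _ (by omega), Int.emod_lt_of_pos _ (by omega)⟩

/-- The defect of the periodic recurrence. -/
noncomputable def defect (α β : ℤ → ℝ) (v : ℕ → ℝ) (k : ℕ) : ℝ :=
  v (k + 2) + α k / α (k + 1) * v k + β (k + 1) / α (k + 1) * v (k + 1)

lemma step_bound (α β : ℤ → ℝ) (N : ℕ) (hN : 1 ≤ N) (hα : ∀ k : ℤ, α (k + N) = α k)
    (hβ : ∀ k : ℤ, β (k + N) = β k) (j : ℕ) :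
    ∃ C : ℝ, 0 ≤ C ∧ ∀ (v : ℕ → ℝ) (k : ℕ),
      ‖![v (k + j), v (k + j + 1)] - (realP α β (k + 1) j).mulVec ![v k, v (k + 1)]‖
        ≤ C * ∑ i ∈ Finset.range j, |defect α β v (k + i)| := by
  obtain ⟨D, hD0, hD⟩ := periodic_bdd N hN (realB α β) (realB_per α β N hα hβ)
  induction j with
  | zero =>
    refine ⟨0, le_rfl, fun v k => ?_⟩
    simp [realP]
  | succ j ih =>
    obtain ⟨C, hC0, hC⟩ := ih
    refine ⟨D * C + 1, by positivity, fun v k => ?_⟩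
    have key : ![v (k + (j + 1)), v (k + (j + 1) + 1)]
        - (realP α β (k + 1) (j + 1)).mulVec ![v k, v (k + 1)]
        = (realB α β (k + 1 + j)).mulVec
          (![v (k + j), v (k + j + 1)] - (realP α β (k + 1) j).mulVec ![v k, v (k + 1)])
          + ![0, defect α β v (k + j)] := by
      rw [realP, Matrix.mulVec_sub, ← Matrix.mulVec_mulVec]
      have : ![v (k + (j + 1)), v (k + (j + 1) + 1)]
          = (realB α β (k + 1 + j)).mulVec ![v (k + j), v (k + j + 1)]
            + ![0, defect α β v (k + j)] := by
        have e1 : (k : ℤ) + 1 + j - 1 = k + j := by ring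
        have e2 : (k : ℤ) + 1 + j = k + j + 1 := by ring
        ext i
        fin_cases i
        · simp [realB, add_assoc]
        · simp only [realB, e1, defect]
          simp [e2]
          rw [show k + (j + 1) + 1 = k + j + 2 by ring]
          ring
      rw [this]
      abel
    rw [key]
    have hs : ∀ i ∈ Finset.range j, (0:ℝ) ≤ |defect α β v (k + i)| := fun _ _ => abs_nonneg _
    have hs' := Finset.sum_nonneg hs
    have hn : ‖![0, defect α β v (k + j)]‖ ≤ |defect α β v (k + j)| := by
      rw [pi_norm_le_iff_of_nonneg (abs_nonneg _)]
      intro i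
      fin_cases i <;> simp
    refine (norm_add_le _ _).trans ?_
    have h1 := (Matrix.linfty_opNorm_mulVec (realB α β (k + 1 + j))
      (![v (k + j), v (k + j + 1)] - (realP α β (k + 1) j).mulVec ![v k, v (k + 1)]))
    have h2 : ‖realB α β (k + 1 + j)‖ *
       ‖![v (k + j), v (k + j + 1)] - (realP α β (k + 1) j).mulVec ![v k, v (k + 1)]‖
       ≤ D * (C * ∑ i ∈ Finset.range j, |defect α β v (k + i)|) := by
      gcongr
      · exact hD _
      · exact hC v k
    rw [Finset.sum_range_succ]
    have h3 : 0 ≤ D * C * |defect α β v (k + j)| := by positivity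
    nlinarith

lemma cayley (X : Matrix (Fin 2) (Fin 2) ℝ) (hd : X.det = 1) (u : Fin 2 → ℝ) :
    X.mulVec (X.mulVec u) = X.trace • X.mulVec u - u := by
  rw [Matrix.det_fin_two] at hd
  ext i
  fin_cases i
  · simp [Matrix.mulVec, dotProduct, Fin.sum_univ_two, Matrix.trace]
    linear_combination -u 0 * hd
  · simp [Matrix.mulVec, dotProduct, Fin.sum_univ_two, Matrix.trace]
    linear_combination -u 1 * hd

lemma three_term (α β : ℤ → ℝ) (N : ℕ) (hN : 1 ≤ N) (hαpos : ∀ k, 0 < α k)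
    (hα : ∀ k : ℤ, α (k + N) = α k)
    (hβ : ∀ k : ℤ, β (k + N) = β k) (τ : ℝ) (hτ : (realP α β 0 N).trace = τ) :
    ∃ C : ℝ, 0 ≤ C ∧ ∀ (v : ℕ → ℝ) (k : ℕ),
      |v (k + 2 * N) - τ * v (k + N) + v k|
        ≤ C * ∑ i ∈ Finset.range (2 * N), |defect α β v (k + i)| := by
  obtain ⟨D, hD0, hD⟩ := periodic_bdd N hN (fun k => realP α β k N)
    (fun k => realP_per α β N hα hβ k N)
  obtain ⟨C, hC0, hC⟩ := step_bound α β N hN hα hβ N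
  refine ⟨C * (1 + D + |τ|), by positivity, fun v k => ?_⟩
  have h1 := hC v k
  have h2 := hC v (k + N)
  have hX : realP α β ((k + N : ℕ) + 1) N = realP α β (k + 1) N := by
    rw [← realP_per α β N hα hβ (k + 1)]
    congr 1; push_cast; ring
  rw [hX] at h2
  set X := realP α β (k + 1) N with hXdef
  have htr : X.trace = τ := by
    rw [← hτ, ← realP_trace α β N hN hα hβ (k + 1)]
    push_cast; rfl
  have hdet : X.det = 1 := by
    rw [hXdef, realP_det α β hαpos]
    have e : (k : ℤ) + 1 + N - 1 = (k + 1 - 1) + N := by ring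
    rw [e, hα, div_self (hαpos _).ne']
  set d1 := ![v (k + N), v (k + N + 1)] - X.mulVec ![v k, v (k + 1)] with hd1
  set d2 := ![v (k + N + N), v (k + N + N + 1)] - X.mulVec ![v (k + N), v (k + N + 1)] with hd2
  have hc := cayley X hdet ![v k, v (k + 1)]
  have hcomb : d2 + X.mulVec d1 - τ • d1
      = ![v (k + N + N), v (k + N + N + 1)] - τ • ![v (k + N), v (k + N + 1)]
        + ![v k, v (k + 1)] := by
    rw [hd1, hd2, Matrix.mulVec_sub, hc, htr, smul_sub]
    abel
  have hval : v (k + 2 * N) - τ * v (k + N) + v k = (d2 + X.mulVec d1 - τ • d1) 0 := by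
    rw [hcomb]
    simp [two_mul, add_assoc]
  rw [hval, ← Real.norm_eq_abs]
  refine (norm_le_pi_norm _ _).trans ?_
  have n1 : ‖X.mulVec d1‖ ≤ D * ‖d1‖ :=
    (Matrix.linfty_opNorm_mulVec X d1).trans (by gcongr; exact hD _)
  have n2 : ‖τ • d1‖ = |τ| * ‖d1‖ := by rw [norm_smul, Real.norm_eq_abs]
  have n3 : ‖d2 + X.mulVec d1 - τ • d1‖ ≤ ‖d2‖ + ‖X.mulVec d1‖ + ‖τ • d1‖ :=
    (norm_sub_le _ _).trans (by gcongr; exact norm_add_le _ _)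
  have hsum : ∑ i ∈ Finset.range (2 * N), |defect α β v (k + i)|
      = ∑ i ∈ Finset.range N, |defect α β v (k + i)|
        + ∑ i ∈ Finset.range N, |defect α β v (k + N + i)| := by
    rw [two_mul, Finset.sum_range_add]
    simp [add_assoc]
  rw [hsum]
  have p1 : 0 ≤ ∑ i ∈ Finset.range N, |defect α β v (k + i)| :=
    Finset.sum_nonneg fun _ _ => abs_nonneg _
  have p2 : 0 ≤ ∑ i ∈ Finset.range N, |defect α β v (k + N + i)| :=
    Finset.sum_nonneg fun _ _ => abs_nonneg _
  set s1 := ∑ i ∈ Finset.range N, |defect α β v (k + i)|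
  set s2 := ∑ i ∈ Finset.range N, |defect α β v (k + N + i)|
  have t1 : (D + |τ|) * ‖d1‖ ≤ (D + |τ|) * (C * s1) := by gcongr
  have t2 : 0 ≤ (D + |τ|) * (C * s2) := by positivity
  have t3 : 0 ≤ C * s1 := by positivity
  nlinarith

lemma sum_shift (f : ℕ → ℝ) (L m : ℕ) (h0 : ∀ k < m, f k = 0) (h1 : ∀ k, L ≤ k → f k = 0) :
    ∑ k ∈ Finset.range L, f (k + m) = ∑ k ∈ Finset.range L, f k := by
  have e1 := Finset.sum_range_add f L m
  have e2 := Finset.sum_range_add f m L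
  rw [Finset.sum_eq_zero (s := Finset.range m) (f := fun x => f (L + x))
    (fun i _ => h1 _ (by omega))] at e1
  rw [Finset.sum_eq_zero (s := Finset.range m) (f := f)
    (fun i hi => h0 _ (Finset.mem_range.1 hi)), add_comm m L, e1] at e2
  simp only [add_comm _ m]
  linarith

lemma sum_shift_le (f : ℕ → ℝ) (hf : ∀ k, 0 ≤ f k) (L m : ℕ) (h1 : ∀ k, L ≤ k → f k = 0) :
    ∑ k ∈ Finset.range L, f (k + m) ≤ ∑ k ∈ Finset.range L, f k := by
  have e1 := Finset.sum_range_add f L m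
  have e2 := Finset.sum_range_add f m L
  rw [Finset.sum_eq_zero (s := Finset.range m) (f := fun x => f (L + x))
    (fun i _ => h1 _ (by omega))] at e1
  rw [add_comm m L, e1] at e2
  simp only [add_comm _ m]
  have : 0 ≤ ∑ x ∈ Finset.range m, f x := Finset.sum_nonneg fun _ _ => hf _
  linarith

lemma coercive (α β : ℤ → ℝ) (N : ℕ) (hN : 1 ≤ N) (hαpos : ∀ k, 0 < α k)
    (hα : ∀ k : ℤ, α (k + N) = α k)
    (hβ : ∀ k : ℤ, β (k + N) = β k) (τ : ℝ) (hτ : (realP α β 0 N).trace = τ)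
    (hτ2 : 4 < τ ^ 2) :
    ∃ C : ℝ, 0 < C ∧ ∀ (v : ℕ → ℝ) (L : ℕ), (∀ k < 2 * N, v k = 0) → (∀ k, L ≤ k → v k = 0) →
      ∑ k ∈ Finset.range L, v k ^ 2 ≤ C * ∑ k ∈ Finset.range L, defect α β v k ^ 2 := by
  obtain ⟨C, hC0, hC⟩ := three_term α β N hN hαpos hα hβ τ hτ
  obtain ⟨δ, hδ0, hδ⟩ : ∃ δ : ℝ, 0 < δ ∧ τ ^ 2 = 4 * (1 + 2 * δ) :=
    ⟨(τ ^ 2 / 4 - 1) / 2, by linarith, by ring⟩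
  refine ⟨(1 + 1 / δ) * (C ^ 2 * (2 * N) * (2 * N)) / (4 * δ) + 1, by positivity, ?_⟩
  intro v L hv0 hv1
  set S := ∑ k ∈ Finset.range L, v k ^ 2 with hS
  set E := ∑ k ∈ Finset.range L, defect α β v k ^ 2 with hE
  have hE0 : 0 ≤ E := Finset.sum_nonneg fun _ _ => sq_nonneg _
  have hpt : ∀ k, τ ^ 2 * v (k + N) ^ 2 ≤ 2 * (1 + δ) * (v (k + 2 * N) ^ 2 + v k ^ 2)
      + (1 + 1 / δ) * (C ^ 2 * (2 * N) *
        ∑ i ∈ Finset.range (2 * N), defect α β v (k + i) ^ 2) := by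
    intro k
    set g := v (k + 2 * N) - τ * v (k + N) + v k with hg
    have hg2 : g ^ 2 ≤ C ^ 2 * (2 * N) *
        ∑ i ∈ Finset.range (2 * N), defect α β v (k + i) ^ 2 := by
      have h1 := hC v k
      have h2 : g ^ 2 ≤ (C * ∑ i ∈ Finset.range (2 * N), |defect α β v (k + i)|) ^ 2 := by
        rw [← sq_abs g]
        gcongr
      refine h2.trans ?_
      rw [mul_pow, mul_assoc]
      gcongr
      have h3 := sq_sum_le_card_mul_sum_sq (s := Finset.range (2 * N))
        (f := fun i => |defect α β v (k + i)|)
      simpa using h3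
    have h5 : (τ * v (k + N)) ^ 2 ≤ (1 + δ) * (v (k + 2 * N) + v k) ^ 2 + (1 + 1 / δ) * g ^ 2 := by
      have : τ * v (k + N) = (v (k + 2 * N) + v k) - g := by rw [hg]; ring
      rw [this]
      set y := v (k + 2 * N) + v k
      have h6 : (1 + δ) * y ^ 2 + (1 + 1 / δ) * g ^ 2 - (y - g) ^ 2
          = (δ * y + g) ^ 2 / δ := by field_simp; ring
      have h7 : 0 ≤ (δ * y + g) ^ 2 / δ := by positivity
      linarith
    have h8 : (1 + δ) * (v (k + 2 * N) + v k) ^ 2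
        ≤ (1 + δ) * (2 * (v (k + 2 * N) ^ 2 + v k ^ 2)) := by
      gcongr
      nlinarith [sq_nonneg (v (k + 2 * N) - v k)]
    have h9 : (1 + 1 / δ) * g ^ 2 ≤ (1 + 1 / δ) * (C ^ 2 * (2 * N) *
        ∑ i ∈ Finset.range (2 * N), defect α β v (k + i) ^ 2) := by gcongr
    nlinarith
  have hsum := Finset.sum_le_sum (s := Finset.range L) fun k _ => hpt k
  simp only [Finset.sum_add_distrib, ← Finset.mul_sum] at hsum
  have q1 : ∑ k ∈ Finset.range L, v (k + N) ^ 2 = S :=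
    sum_shift (fun k => v k ^ 2) L N (fun k hk => by simp [hv0 k (by omega)])
      (fun k hk => by simp [hv1 k hk])
  have q2 : ∑ k ∈ Finset.range L, v (k + 2 * N) ^ 2 = S :=
    sum_shift (fun k => v k ^ 2) L (2 * N) (fun k hk => by simp [hv0 k (by omega)])
      (fun k hk => by simp [hv1 k hk])
  have q3 : ∑ k ∈ Finset.range L, ∑ i ∈ Finset.range (2 * N), defect α β v (k + i) ^ 2
      ≤ (2 * N) * E := by
    rw [Finset.sum_comm]
    have : ∀ i ∈ Finset.range (2 * N), ∑ k ∈ Finset.range L, defect α β v (k + i) ^ 2 ≤ E :=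
      fun i _ => sum_shift_le (fun k => defect α β v k ^ 2) (fun _ => sq_nonneg _) L i
        (fun k hk => by
          simp [defect, hv1 k hk, hv1 (k + 1) (by omega), hv1 (k + 2) (by omega)])
    refine (Finset.sum_le_card_nsmul _ _ _ this).trans ?_
    simp
  rw [q1, q2, ← hS] at hsum
  have q4 : (1 + 1 / δ) * (C ^ 2 * (2 * N) *
      ∑ k ∈ Finset.range L, ∑ i ∈ Finset.range (2 * N), defect α β v (k + i) ^ 2)
      ≤ (1 + 1 / δ) * (C ^ 2 * (2 * N) * ((2 * N) * E)) := by gcongr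
  have q5 : 4 * δ * S ≤ (1 + 1 / δ) * (C ^ 2 * (2 * N) * (2 * N)) * E := by
    rw [hδ] at hsum
    have := hsum.trans (add_le_add_right q4 _)
    linarith
  have q6 : S ≤ (1 + 1 / δ) * (C ^ 2 * (2 * N) * (2 * N)) / (4 * δ) * E := by
    rw [div_mul_eq_mul_div, le_div_iff₀ (by positivity)]
    linarith
  linarith

lemma christoffel (a b : ℕ → ℝ) (p : ℕ → ℝ → ℝ) (ha : ∀ n, 0 < a n)
    (hp0 : ∀ x : ℝ, p 0 x = 1)
    (hp1 : ∀ x : ℝ, p 1 x = (x - b 0) / a 0)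
    (hprec : ∀ n : ℕ, ∀ x : ℝ,
      a n * p n x + b (n + 1) * p (n + 1) x + a (n + 1) * p (n + 2) x = x * p (n + 1) x)
    (n : ℕ) (x y : ℝ) :
    (x - y) * ∑ k ∈ Finset.range (n + 1), p k x * p k y
      = a n * (p (n + 1) x * p n y - p n x * p (n + 1) y) := by
  induction n with
  | zero =>
    have := (ha 0).ne'
    simp only [zero_add, Finset.sum_range_one, hp0, hp1]
    field_simp
    ring
  | succ n ih =>
    rw [Finset.sum_range_succ, mul_add, ih]
    have hx := hprec n x
    have hy := hprec n y
    linear_combination -p (n + 1) y * hx + p (n + 1) x * hy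

/-- Lower bound for the tail of the Jacobi operator. -/
lemma tail_bound (N : ℕ) (hN : 1 ≤ N)
    (a b : ℕ → ℝ) (ha : ∀ n, 0 < a n)
    (α β : ℤ → ℝ) (hαpos : ∀ k, 0 < α k)
    (hαper : ∀ k : ℤ, α (k + N) = α k) (hβper : ∀ k : ℤ, β (k + N) = β k)
    (hmod1 : Tendsto a atTop atTop)
    (hmod2 : Tendsto (fun n : ℕ => a n / a (n + 1) - α n / α (n + 1)) atTop (𝓝 0))
    (hmod3 : Tendsto (fun n : ℕ => b n / a n - β n / α n) atTop (𝓝 0))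
    (τ : ℝ) (hτ : (realP α β 0 N).trace = τ) (hτ2 : 4 < τ ^ 2) (R : ℝ) :
    ∃ M : ℕ, ∀ (v : ℕ → ℝ) (L : ℕ), (∀ k < M, v k = 0) → (∀ k, L ≤ k → v k = 0) →
      ∑ k ∈ Finset.range L, (a k * v k + b (k + 1) * v (k + 1) + a (k + 1) * v (k + 2)) ^ 2
        ≤ R ^ 2 * ∑ k ∈ Finset.range L, v k ^ 2 →
      ∑ k ∈ Finset.range L, v k ^ 2 = 0 := by
  obtain ⟨C, hC0, hC⟩ := coercive α β N hN hαpos hαper hβper τ hτ hτ2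
  obtain ⟨ε, hε0, hε⟩ : ∃ ε : ℝ, 0 < ε ∧ 6 * C * ε ^ 2 ≤ 1 / 2 := by
    refine ⟨1 / (12 * C + 1), by positivity, ?_⟩
    rw [div_pow, one_pow, mul_one_div, div_le_div_iff₀ (by positivity) (by norm_num)]
    nlinarith
  obtain ⟨A, hA0, hA⟩ : ∃ A : ℝ, 0 < A ∧ 12 * C * R ^ 2 ≤ A ^ 2 := by
    refine ⟨12 * C * R ^ 2 + 1, by positivity, ?_⟩
    have : 0 ≤ 12 * C * R ^ 2 := by positivity
    nlinarith
  have ev1 : ∀ᶠ k in atTop, A + 1 ≤ a k := hmod1.eventually_ge_atTop _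
  have ev2 : ∀ᶠ k : ℕ in atTop, |a k / a (k + 1) - α k / α (k + 1)| < ε := by
    simpa using hmod2.eventually (Metric.ball_mem_nhds 0 hε0)
  have ev3 : ∀ᶠ k : ℕ in atTop, |b k / a k - β k / α k| < ε := by
    simpa using hmod3.eventually (Metric.ball_mem_nhds 0 hε0)
  obtain ⟨K, hK⟩ := eventually_atTop.1 (ev1.and (ev2.and ev3))
  refine ⟨K + 2 + 2 * N, fun v L hv0 hv1 hW => ?_⟩
  set w : ℕ → ℝ := fun k => a k * v k + b (k + 1) * v (k + 1) + a (k + 1) * v (k + 2) with hw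
  set S := ∑ k ∈ Finset.range L, v k ^ 2 with hS
  have hS0 : 0 ≤ S := Finset.sum_nonneg fun _ _ => sq_nonneg _
  have hpt : ∀ k, defect α β v k ^ 2
      ≤ 3 / A ^ 2 * w k ^ 2 + 3 * ε ^ 2 * (v k ^ 2 + v (k + 1) ^ 2) := by
    intro k
    by_cases hk : k < K
    · have : defect α β v k = 0 := by
        simp [defect, hv0 k (by omega), hv0 (k + 1) (by omega), hv0 (k + 2) (by omega)]
      rw [this, zero_pow two_ne_zero]
      positivity
    · obtain ⟨-, h2, -⟩ := hK k (by omega)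
      obtain ⟨h1, -, h3⟩ := hK (k + 1) (by omega)
      push_cast at h3
      set r := a k / a (k + 1) - α k / α (k + 1)
      set s := b (k + 1) / a (k + 1) - β (k + 1) / α (k + 1)
      have hne := (ha (k + 1)).ne'
      have hd : defect α β v k = w k / a (k + 1) - r * v k - s * v (k + 1) := by
        simp only [defect, hw, r, s]
        field_simp
        ring
      have hx : (w k / a (k + 1)) ^ 2 ≤ w k ^ 2 / A ^ 2 := by
        rw [div_pow]
        gcongr
        linarith
      have hr : r ^ 2 ≤ ε ^ 2 := by rw [← sq_abs r]; gcongr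
      have hs : s ^ 2 ≤ ε ^ 2 := by rw [← sq_abs s]; gcongr
      have h4 : (r * v k) ^ 2 ≤ ε ^ 2 * v k ^ 2 := by rw [mul_pow]; gcongr
      have h5 : (s * v (k + 1)) ^ 2 ≤ ε ^ 2 * v (k + 1) ^ 2 := by rw [mul_pow]; gcongr
      have h6 : defect α β v k ^ 2
          ≤ 3 * ((w k / a (k + 1)) ^ 2 + (r * v k) ^ 2 + (s * v (k + 1)) ^ 2) := by
        rw [hd]
        generalize w k / a (k + 1) = x
        generalize r * v k = y
        generalize s * v (k + 1) = z
        nlinarith [sq_nonneg (x + y), sq_nonneg (x + z), sq_nonneg (y - z)]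
      have h7 : 3 / A ^ 2 * w k ^ 2 = 3 * (w k ^ 2 / A ^ 2) := by ring
      rw [h7]
      linarith
  have hsum := Finset.sum_le_sum (s := Finset.range L) fun k _ => hpt k
  simp only [Finset.sum_add_distrib, ← Finset.mul_sum] at hsum
  have q1 : ∑ k ∈ Finset.range L, v (k + 1) ^ 2 = S :=
    sum_shift (fun k => v k ^ 2) L 1 (fun k hk => by simp [hv0 k (by omega)])
      (fun k hk => by simp [hv1 k hk])
  rw [q1, ← hS] at hsum
  have hco := hC v L (fun k hk => hv0 k (by omega)) hv1
  rw [← hS] at hco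
  have q2 : 3 / A ^ 2 * ∑ k ∈ Finset.range L, w k ^ 2 ≤ 3 / A ^ 2 * (R ^ 2 * S) := by
    gcongr
  have q3 : C * (3 / A ^ 2 * (R ^ 2 * S)) ≤ S / 4 := by
    have : C * (3 / A ^ 2 * (R ^ 2 * S)) = (12 * C * R ^ 2) * S / (4 * A ^ 2) := by
      field_simp
      ring
    rw [this, div_le_div_iff₀ (by positivity) (by norm_num)]
    have := mul_le_mul_of_nonneg_right hA hS0
    linarith
  have q4 : C * ∑ k ∈ Finset.range L, defect α β v k ^ 2
      ≤ C * (3 / A ^ 2 * (R ^ 2 * S) + 3 * ε ^ 2 * (S + S)) := by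
    gcongr
    linarith
  have q5 : 6 * C * ε ^ 2 * S ≤ 1 / 2 * S := by gcongr
  have : C * (3 / A ^ 2 * (R ^ 2 * S) + 3 * ε ^ 2 * (S + S))
      = C * (3 / A ^ 2 * (R ^ 2 * S)) + 6 * C * ε ^ 2 * S := by ring
  linarith

/-- Sum of squares of a combination of orthogonal vectors. -/
lemma sq_orth (T : Finset ℝ) (q : ℕ → ℝ → ℝ) (n : ℕ) (c : ℝ → ℝ)
    (horth : ∀ x ∈ T, ∀ y ∈ T, x ≠ y → ∑ k ∈ Finset.range n, q k x * q k y = 0) :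
    ∑ k ∈ Finset.range n, (∑ y ∈ T, c y * q k y) ^ 2
      = ∑ y ∈ T, c y ^ 2 * ∑ k ∈ Finset.range n, q k y ^ 2 := by
  have h1 : ∀ k, (∑ y ∈ T, c y * q k y) ^ 2
      = ∑ x ∈ T, ∑ y ∈ T, c x * c y * (q k x * q k y) := by
    intro k
    rw [sq, Finset.sum_mul_sum]
    refine Finset.sum_congr rfl fun x _ => Finset.sum_congr rfl fun y _ => by ring
  simp only [h1]
  rw [Finset.sum_comm]
  refine Finset.sum_congr rfl fun x hx => ?_
  rw [Finset.sum_comm, Finset.sum_eq_single x]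
  · rw [← Finset.mul_sum]
    simp only [sq]
  · intro y hy hyx
    rw [← Finset.mul_sum, horth x hx y hy (Ne.symm hyx), mul_zero]
  · intro h; exact absurd hx h

lemma exists_combination (T : Finset ℝ) (q : ℕ → ℝ → ℝ) (M n : ℕ) (hT : M + 1 < T.card) :
    ∃ c : ℝ → ℝ, (∃ y ∈ T, c y ≠ 0) ∧ (∀ k < M, ∑ y ∈ T, c y * q k y = 0)
      ∧ ∑ y ∈ T, c y * q n y = 0 := by
  let g : Fin (M + 1) → ℕ := fun i => if (i : ℕ) < M then i else n
  let A : Matrix (Fin (M + 1)) T ℝ := Matrix.of fun i y => q (g i) y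
  have hk : LinearMap.ker A.mulVecLin ≠ ⊥ :=
    LinearMap.ker_ne_bot_of_finrank_lt (by simpa using hT)
  obtain ⟨c, hc, hc0⟩ := Submodule.exists_mem_ne_zero_of_ne_bot hk
  have hz : ∀ i : Fin (M + 1), ∑ y ∈ T, (if h : y ∈ T then c ⟨y, h⟩ else 0) * q (g i) y = 0 := by
    intro i
    have h1 := congrFun (LinearMap.mem_ker.1 hc) i
    simp only [Matrix.mulVecLin_apply, Matrix.mulVec, dotProduct, A, Matrix.of_apply,
      Pi.zero_apply] at h1
    rw [← Finset.sum_coe_sort, ← h1]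
    refine Finset.sum_congr rfl fun y _ => ?_
    simp [mul_comm]
  refine ⟨fun y => if h : y ∈ T then c ⟨y, h⟩ else 0, ?_, ?_, ?_⟩
  · obtain ⟨y, hy⟩ := Function.ne_iff.1 hc0
    exact ⟨y, y.2, by simpa using hy⟩
  · intro k hk
    simpa [g, hk] using hz ⟨k, by omega⟩
  · simpa [g] using hz ⟨M, by omega⟩

/-- Theorem B = Theorem A:2 of the paper. -/
theorem stmt_18
    (N : ℕ) (hN : 1 ≤ N)
    (a b : ℕ → ℝ) (ha : ∀ n, 0 < a n)
    (α β : ℤ → ℝ) (hαpos : ∀ k, 0 < α k)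
    (hαper : ∀ k : ℤ, α (k + N) = α k) (hβper : ∀ k : ℤ, β (k + N) = β k)
    (hmod1 : Tendsto a atTop atTop)
    (hmod2 : Tendsto (fun n : ℕ => a n / a (n + 1) - α n / α (n + 1)) atTop (𝓝 0))
    (hmod3 : Tendsto (fun n : ℕ => b n / a n - β n / α n) atTop (𝓝 0))
    (p : ℕ → ℝ → ℝ)
    (hp0 : ∀ x : ℝ, p 0 x = 1)
    (hp1 : ∀ x : ℝ, p 1 x = (x - b 0) / a 0)
    (hprec : ∀ n : ℕ, ∀ x : ℝ,
      a n * p n x + b (n + 1) * p (n + 1) x + a (n + 1) * p (n + 2) x = x * p (n + 1) x)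
    (Z : ℕ → Finset ℝ)
    (hZcard : ∀ n, (Z n).card = n + 1)
    (hZ : ∀ n, ∀ y : ℝ, y ∈ Z n ↔ p (n + 1) y = 0)
    (τ : ℝ) (hτ : Matrix.trace (frakX α β N (N : ℤ) 0) = (τ : ℂ))
    (hτmem : τ ∉ Set.Icc (-2 : ℝ) 2)
    (hD1a : MemD1N N (fun n => a n / a (n + 1)))
    (hD1b : MemD1N N (fun n => b n / a n))
    (hD1c : MemD1N N (fun n => 1 / a n)) :
    ∀ ρ : ℕ → ℝ, (∀ n, 0 < ρ n) → Tendsto ρ atTop atTop →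
      ∀ f : ℝ → ℝ, Continuous f → HasCompactSupport f →
        Tendsto (fun n => (ρ n)⁻¹ * ∑ y ∈ Z n, f y) atTop (𝓝 0) := by
  intro ρ hρ hρt f hf hfc
  -- trace
  have hτ' : (realP α β 0 N).trace = τ := by
    rw [← realP_trace α β N hN hαper hβper N]
    rw [frakX_eq_map] at hτ
    apply Complex.ofReal_injective
    rw [← hτ]
    simp [Matrix.trace]
  have hτ2 : 4 < τ ^ 2 := by
    by_contra h
    apply hτmem
    constructor <;> nlinarith
  -- support
  obtain ⟨R, hR⟩ : ∃ R : ℝ, ∀ y, f y ≠ 0 → |y| ≤ R := by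
    obtain ⟨R, hR⟩ := hfc.isCompact.isBounded.exists_norm_le
    exact ⟨R, fun y hy => hR y (subset_tsupport f hy)⟩
  obtain ⟨B, hB⟩ : ∃ B : ℝ, ∀ y, |f y| ≤ B := by
    obtain ⟨B, hB⟩ := hfc.exists_bound_of_continuous hf
    exact ⟨B, hB⟩
  have hB0 : 0 ≤ B := (abs_nonneg _).trans (hB 0)
  obtain ⟨M, hM⟩ := tail_bound N hN a b ha α β hαpos hαper hβper hmod1 hmod2 hmod3 τ hτ' hτ2 R
  have hcount : ∀ n, ((Z n).filter (fun y => f y ≠ 0)).card ≤ M + 1 := by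
    intro n
    by_contra hlt
    push Not at hlt
    set T := (Z n).filter (fun y => f y ≠ 0) with hT
    obtain ⟨c, ⟨y0, hy0, hc0⟩, hcM, hcn⟩ := exists_combination T p M n hlt
    have hroot : ∀ y ∈ T, p (n + 1) y = 0 := fun y hy =>
      (hZ n y).1 (Finset.mem_filter.1 hy).1
    have hRT : ∀ y ∈ T, y ^ 2 ≤ R ^ 2 := fun y hy => by
      have := hR y (Finset.mem_filter.1 hy).2
      rw [← sq_abs y]
      gcongr
    have horth : ∀ x ∈ T, ∀ y ∈ T, x ≠ y →
        ∑ k ∈ Finset.range (n + 1), p k x * p k y = 0 := by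
      intro x hx y hy hxy
      have h := christoffel a b p ha hp0 hp1 hprec n x y
      rw [hroot x hx, hroot y hy] at h
      simpa [sub_ne_zero.2 hxy] using h
    have hS := sq_orth T p (n + 1) c horth
    have hS' := sq_orth T p (n + 1) (fun y => c y * y) horth
    set V : ℕ → ℝ := fun k => ∑ y ∈ T, c y * p k y with hV
    have hVn1 : V (n + 1) = 0 := Finset.sum_eq_zero fun y hy => by simp [hroot y hy]
    have hVrec : ∀ k, a k * V k + b (k + 1) * V (k + 1) + a (k + 1) * V (k + 2)
        = ∑ y ∈ T, c y * y * p (k + 1) y := by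
      intro k
      simp only [hV, Finset.mul_sum, ← Finset.sum_add_distrib]
      refine Finset.sum_congr rfl fun y _ => ?_
      linear_combination c y * hprec k y
    set v : ℕ → ℝ := fun k => if k ≤ n then V k else 0 with hv
    have hvV : ∀ k ≤ n + 1, v k = V k := by
      intro k hk
      rcases Nat.lt_or_ge n k with h | h
      · have : k = n + 1 := by omega
        subst this
        simp [hv, hVn1]
      · simp [hv, h]
    have hvz : ∀ k, n ≤ k → v k = 0 := by
      intro k hk
      rcases Nat.lt_or_ge n k with h | h
      · simp [hv, h]
      · have : k = n := by omega
        subst this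
        rw [hvV k (by omega)]
        exact hcn
    have hvS : ∑ k ∈ Finset.range (n + 1), v k ^ 2
        = ∑ y ∈ T, c y ^ 2 * ∑ k ∈ Finset.range (n + 1), p k y ^ 2 := by
      rw [← hS]
      refine Finset.sum_congr rfl fun k hk => ?_
      rw [hvV k (by have := Finset.mem_range.1 hk; omega)]
    have hzero := hM v (n + 1) (fun k hk => by
        by_cases h : k ≤ n
        · rw [hvV k (by omega)]; exact hcM k hk
        · exact hvz k (by omega)) (fun k hk => hvz k (by omega)) (by
        rw [hvS, Finset.sum_range_succ, hvz n le_rfl, hvz (n + 1) (by omega),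
          hvz (n + 2) (by omega)]
        have e1 : ∑ k ∈ Finset.range n,
            (a k * v k + b (k + 1) * v (k + 1) + a (k + 1) * v (k + 2)) ^ 2
            = ∑ k ∈ Finset.range n, (∑ y ∈ T, c y * y * p (k + 1) y) ^ 2 := by
          refine Finset.sum_congr rfl fun k hk => ?_
          have := Finset.mem_range.1 hk
          rw [hvV k (by omega), hvV (k + 1) (by omega), hvV (k + 2) (by omega), hVrec]
        have e2 : ∑ k ∈ Finset.range n, (∑ y ∈ T, c y * y * p (k + 1) y) ^ 2
            ≤ ∑ k ∈ Finset.range (n + 1), (∑ y ∈ T, c y * y * p k y) ^ 2 := by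
          rw [Finset.sum_range_succ']
          exact le_add_of_nonneg_right (sq_nonneg _)
        rw [hS'] at e2
        rw [e1]
        simp only [mul_zero, add_zero]
        rw [zero_pow two_ne_zero, add_zero]
        refine e2.trans ?_
        rw [Finset.mul_sum]
        refine Finset.sum_le_sum fun y hy => ?_
        have hp : 0 ≤ ∑ k ∈ Finset.range (n + 1), p k y ^ 2 :=
          Finset.sum_nonneg fun _ _ => sq_nonneg _
        have := mul_le_mul_of_nonneg_right (hRT y hy)
          (mul_nonneg (sq_nonneg (c y)) hp)
        rw [mul_pow]
        linarith)
    rw [hvS] at hzero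
    have hpos : ∀ y, 0 < ∑ k ∈ Finset.range (n + 1), p k y ^ 2 := by
      intro y
      refine Finset.sum_pos' (fun _ _ => sq_nonneg _) ⟨0, by simp, by simp [hp0]⟩
    have h0 := (Finset.sum_eq_zero_iff_of_nonneg
      (fun y _ => mul_nonneg (sq_nonneg (c y)) (hpos y).le)).1 hzero y0 hy0
    rcases mul_eq_zero.1 h0 with h | h
    · exact hc0 (by simpa using h)
    · exact (hpos y0).ne' h
  have hbound : ∀ n, |∑ y ∈ Z n, f y| ≤ (M + 1) * B := by
    intro n
    rw [← Finset.sum_filter_ne_zero]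
    refine (Finset.abs_sum_le_sum_abs _ _).trans ?_
    refine (Finset.sum_le_card_nsmul _ _ B fun y _ => hB y).trans ?_
    rw [nsmul_eq_mul]
    gcongr
    exact_mod_cast hcount n
  have hinv : Tendsto (fun n => (ρ n)⁻¹ * ((M + 1) * B)) atTop (𝓝 0) := by
    simpa using (tendsto_inv_atTop_zero.comp hρt).mul_const ((M + 1) * B)
  refine squeeze_zero_norm (fun n => ?_) hinv
  rw [norm_mul, Real.norm_eq_abs, Real.norm_eq_abs, abs_of_pos (inv_pos.2 (hρ n))]
  have := hρ n
  gcongr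
  exact hbound n
end
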